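/- arXiv:1905.11504 — 2 statements merged into one kernel-verified Lean document; each statement's English description precedes it below -/
import Mathlib

section
/- As α → ∞, the extremal Frank-Kamenetskii parameter satisfies lim_{α→∞} λ*(α) · (2Kα/log α)^{−1} = 1. -/
open Set MeasureTheory Filter

/-- The standing data and assumptions of the Gelfand-type problem for
auto-ignition of a free round turbulent jet:
`f : [0,∞) → (0,∞)` is `C¹`, convex, non-decreasing with `K = ∫₀^∞ ds / f s < ∞`;
`φ, ψ : [0,1] → [0,∞)` are non-increasing Lipschitz with `φ 0 = ψ 0 = 1`,
`φ > 0` on `[0,1)`, and `M s = max_{r ∈ [0,s]} ψ r / φ r` is integrable on `(0,1)`. -/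
structure GelfandData where
  f : ℝ → ℝ
  phi : ℝ → ℝ
  psi : ℝ → ℝ
  M : ℝ → ℝ
  K : ℝ
  f_pos : ∀ s, 0 ≤ s → 0 < f s
  f_smooth : ContDiffOn ℝ 1 f (Ici 0)
  f_convex : ConvexOn ℝ (Ici 0) f
  f_mono : MonotoneOn f (Ici 0)
  f_int : IntegrableOn (fun s => 1 / f s) (Ioi 0)
  K_def : K = ∫ s in Ioi (0:ℝ), 1 / f s
  phi_nonneg : ∀ r ∈ Icc (0:ℝ) 1, 0 ≤ phi r
  psi_nonneg : ∀ r ∈ Icc (0:ℝ) 1, 0 ≤ psi r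
  phi_anti : AntitoneOn phi (Icc 0 1)
  psi_anti : AntitoneOn psi (Icc 0 1)
  phi_lip : ∃ L, LipschitzOnWith L phi (Icc 0 1)
  psi_lip : ∃ L, LipschitzOnWith L psi (Icc 0 1)
  phi_zero : phi 0 = 1
  psi_zero : psi 0 = 1
  phi_pos : ∀ r ∈ Ico (0:ℝ) 1, 0 < phi r
  M_def : ∀ s ∈ Ico (0:ℝ) 1, IsGreatest ((fun r => psi r / phi r) '' Icc 0 s) (M s)
  M_int : IntegrableOn M (Ioo 0 1)

/-- `u` is a (classical, radial) solution of problem `(P_{α,λ})`: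
`u ∈ C²((0,1)) ∩ C¹([0,1])`, `u > 0` on `[0,1)`, `u'(0) = 0`, `u 1 = 0`, and
`-u'' - (1/r + α r φ(r)) u' = λ ψ(r) f(u(r))` on `(0,1)`. -/
def IsSolution (D : GelfandData) (α lam : ℝ) (u : ℝ → ℝ) : Prop :=
  ContDiffOn ℝ 1 u (Icc 0 1) ∧ ContDiffOn ℝ 2 u (Ioo 0 1) ∧
  (∀ r ∈ Ico (0:ℝ) 1, 0 < u r) ∧
  derivWithin u (Icc 0 1) 0 = 0 ∧ u 1 = 0 ∧
  ∀ r ∈ Ioo (0:ℝ) 1,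
    -(derivWithin (derivWithin u (Icc 0 1)) (Ioo 0 1) r)
      - (1 / r + α * r * D.phi r) * derivWithin u (Icc 0 1) r
      = lam * D.psi r * D.f (u r)

/-- The set of `λ > 0` for which problem `(P_{α,λ})` admits a solution. -/
def solvableSet (D : GelfandData) (α : ℝ) : Set ℝ :=
  {lam | 0 < lam ∧ ∃ u, IsSolution D α lam u}

/-- The extremal Frank-Kamenetskii parameter `λ*(α)`. -/
noncomputable def lamStar (D : GelfandData) (α : ℝ) : ℝ := sSup (solvableSet D α)

/-- The weight `μ(r) = exp(α ∫₀^r s φ(s) ds)`. -/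
noncomputable def muW (D : GelfandData) (α r : ℝ) : ℝ :=
  Real.exp (α * ∫ s in (0:ℝ)..r, s * D.phi s)

/-- `u` is a semistable solution: for every `C¹` test function `η` with `η 1 = 0`,
`∫₀¹ η'^2 μ r dr ≥ λ ∫₀¹ ψ f'(u) η² μ r dr`. -/
def IsSemistable (D : GelfandData) (α lam : ℝ) (u : ℝ → ℝ) : Prop :=
  ∀ η : ℝ → ℝ, ContDiff ℝ 1 η → η 1 = 0 →
    lam * ∫ r in Ioo (0:ℝ) 1,
        D.psi r * derivWithin D.f (Ici 0) (u r) * (η r) ^ 2 * muW D α r * r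
      ≤ ∫ r in Ioo (0:ℝ) 1, (deriv η r) ^ 2 * muW D α r * r

noncomputable def clampI (A s : ℝ) : ℝ := max 0 (min s A)
noncomputable def fh (D : GelfandData) (A s : ℝ) : ℝ := D.f (clampI A s)
noncomputable def pt (D : GelfandData) (r : ℝ) : ℝ := D.phi (clampI 1 r)
noncomputable def qt (D : GelfandData) (r : ℝ) : ℝ := D.psi (clampI 1 r)
noncomputable def mw (D : GelfandData) (α r : ℝ) : ℝ :=
  Real.exp (α * ∫ s in (0:ℝ)..r, s * pt D s)
noncomputable def aa (D : GelfandData) (α t : ℝ) : ℝ := qt D t * t * mw D α t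
noncomputable def PP (D : GelfandData) (α : ℝ) (h : ℝ → ℝ) (s : ℝ) : ℝ :=
  ∫ t in (0:ℝ)..s, aa D α t * h t
noncomputable def QQ (D : GelfandData) (α : ℝ) (h : ℝ → ℝ) (s : ℝ) : ℝ :=
  s * (∫ τ in (0:ℝ)..1, qt D (s*τ) * mw D α (s*τ) * h (s*τ) * τ) / mw D α s
noncomputable def GG (D : GelfandData) (α : ℝ) : ℝ :=
  ∫ s in (0:ℝ)..1, QQ D α (fun _ => 1) s

lemma clampI_cont (A : ℝ) : Continuous (clampI A) := by unfold clampI; fun_prop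
lemma clampI_mono (A : ℝ) : Monotone (clampI A) := by
  intro x y h; unfold clampI; gcongr
lemma clampI_mem {A : ℝ} (hA : 0 ≤ A) (s : ℝ) : clampI A s ∈ Icc 0 A := by
  unfold clampI; constructor
  · exact le_max_left _ _
  · exact max_le hA (min_le_right _ _)
lemma clampI_eq {A s : ℝ} (hs : s ∈ Icc 0 A) : clampI A s = s := by
  unfold clampI; rw [min_eq_left hs.2, max_eq_right hs.1]
lemma clampI_lip (A : ℝ) {a b : ℝ} (h : a ≤ b) : clampI A b - clampI A a ≤ b - a := by
  unfold clampI; rcases max_cases 0 (min b A) with h1 | h1 <;>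
  rcases max_cases 0 (min a A) with h2 | h2 <;> rcases min_cases b A with h3 | h3 <;>
  rcases min_cases a A with h4 | h4 <;> linarith

lemma f_contOn (D : GelfandData) : ContinuousOn D.f (Ici 0) := D.f_smooth.continuousOn
lemma fh_cont (D : GelfandData) {A : ℝ} (hA : 0 ≤ A) : Continuous (fh D A) :=
  (f_contOn D).comp_continuous (clampI_cont A) (fun x => (clampI_mem hA x).1)
lemma fh_mono (D : GelfandData) {A : ℝ} (hA : 0 ≤ A) : Monotone (fh D A) := fun x y h =>
  D.f_mono (clampI_mem hA x).1 (clampI_mem hA y).1 (clampI_mono A h)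
lemma fh_ge (D : GelfandData) {A : ℝ} (hA : 0 ≤ A) (s : ℝ) : D.f 0 ≤ fh D A s :=
  D.f_mono self_mem_Ici (clampI_mem hA s).1 (clampI_mem hA s).1
lemma fh_le (D : GelfandData) {A : ℝ} (hA : 0 ≤ A) (s : ℝ) : fh D A s ≤ D.f A :=
  D.f_mono (clampI_mem hA s).1 hA (clampI_mem hA s).2
lemma fh_pos (D : GelfandData) {A : ℝ} (hA : 0 ≤ A) (s : ℝ) : 0 < fh D A s :=
  D.f_pos _ (clampI_mem hA s).1
lemma fh_eq (D : GelfandData) {A s : ℝ} (hs : s ∈ Icc 0 A) : fh D A s = D.f s := by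
  unfold fh; rw [clampI_eq hs]
lemma f_slope (D : GelfandData) {A a b : ℝ} (ha : 0 ≤ a) (hab : a ≤ b) (hb : b ≤ A) :
    D.f b - D.f a ≤ (D.f (A+1) - D.f A) * (b - a) := by
  rcases hab.eq_or_lt with rfl | hlt
  · simp
  have hA : 0 ≤ A := by linarith
  have hA1 : A + 1 ∈ Ici (0:ℝ) := by simp; linarith
  have h1 := D.f_convex.secant_mono (a := a) (x := b) (y := A+1) ha
    (by simp; linarith) hA1 (by linarith) (by linarith) (by linarith)
  have h2 := D.f_convex.secant_mono (a := A+1) (x := a) (y := A) hA1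
    ha hA (by linarith) (by linarith) (by linarith)
  have e1 : (D.f a - D.f (A+1)) / (a - (A+1)) = (D.f (A+1) - D.f a) / ((A+1) - a) := by
    rw [← neg_sub, ← neg_sub (A+1) a, neg_div_neg_eq]
  have e2 : (D.f A - D.f (A+1)) / (A - (A+1)) = (D.f (A+1) - D.f A) := by
    rw [← neg_sub, ← neg_sub (A+1) A, neg_div_neg_eq]; simp
  rw [e1, e2] at h2
  have h3 := h1.trans h2
  rwa [div_le_iff₀ (by linarith)] at h3
lemma fh_lip (D : GelfandData) {A a b : ℝ} (hA : 0 ≤ A) (hab : a ≤ b) :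
    fh D A b - fh D A a ≤ (D.f (A+1) - D.f A) * (b - a) := by
  have h1 := f_slope D (clampI_mem hA a).1 (clampI_mono A hab) (clampI_mem hA b).2
  refine h1.trans (mul_le_mul_of_nonneg_left (clampI_lip A hab) ?_)
  have := D.f_mono (a := A) (b := A+1) hA (by simp; linarith) (by linarith)
  linarith

lemma pt_cont (D : GelfandData) : Continuous (pt D) := by
  obtain ⟨L, hL⟩ := D.phi_lip
  exact hL.continuousOn.comp_continuous (clampI_cont 1) (fun x => clampI_mem zero_le_one x)
lemma qt_cont (D : GelfandData) : Continuous (qt D) := by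
  obtain ⟨L, hL⟩ := D.psi_lip
  exact hL.continuousOn.comp_continuous (clampI_cont 1) (fun x => clampI_mem zero_le_one x)
lemma pt_nonneg (D : GelfandData) (r : ℝ) : 0 ≤ pt D r :=
  D.phi_nonneg _ (clampI_mem zero_le_one r)
lemma qt_nonneg (D : GelfandData) (r : ℝ) : 0 ≤ qt D r :=
  D.psi_nonneg _ (clampI_mem zero_le_one r)
lemma pt_le_one (D : GelfandData) (r : ℝ) : pt D r ≤ 1 := by
  rw [← D.phi_zero]
  exact D.phi_anti (by simp) (clampI_mem zero_le_one r) (clampI_mem zero_le_one r).1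
lemma qt_le_one (D : GelfandData) (r : ℝ) : qt D r ≤ 1 := by
  rw [← D.psi_zero]
  exact D.psi_anti (by simp) (clampI_mem zero_le_one r) (clampI_mem zero_le_one r).1
lemma pt_zero (D : GelfandData) : pt D 0 = 1 := by
  unfold pt; rw [clampI_eq (by simp), D.phi_zero]
lemma qt_zero (D : GelfandData) : qt D 0 = 1 := by
  unfold qt; rw [clampI_eq (by simp), D.psi_zero]
lemma pt_eq (D : GelfandData) {r : ℝ} (hr : r ∈ Icc (0:ℝ) 1) : pt D r = D.phi r := by
  unfold pt; rw [clampI_eq hr]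
lemma qt_eq (D : GelfandData) {r : ℝ} (hr : r ∈ Icc (0:ℝ) 1) : qt D r = D.psi r := by
  unfold qt; rw [clampI_eq hr]

lemma mw_deriv (D : GelfandData) (α r : ℝ) :
    HasDerivAt (mw D α) (α * (r * pt D r) * mw D α r) r := by
  have hc : Continuous (fun s => s * pt D s) := continuous_id.mul (pt_cont D)
  have h := ((intervalIntegral.integral_hasDerivAt_right (hc.intervalIntegrable 0 r)
    (hc.stronglyMeasurableAtFilter _ _) hc.continuousAt).const_mul α).exp
  unfold mw
  convert h using 1
  ring
lemma mw_cont (D : GelfandData) (α : ℝ) : Continuous (mw D α) :=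
  continuous_iff_continuousAt.2 fun r => (mw_deriv D α r).continuousAt
lemma mw_pos (D : GelfandData) (α r : ℝ) : 0 < mw D α r := Real.exp_pos _
lemma mw_zero (D : GelfandData) (α : ℝ) : mw D α 0 = 1 := by simp [mw]
lemma mw_mono (D : GelfandData) {α : ℝ} (hα : 0 ≤ α) : MonotoneOn (mw D α) (Ici 0) := by
  apply monotoneOn_of_deriv_nonneg (convex_Ici 0) (mw_cont D α).continuousOn
  · exact fun x _ => (mw_deriv D α x).differentiableAt.differentiableWithinAt
  · intro x hx
    rw [interior_Ici] at hx
    rw [(mw_deriv D α x).deriv]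
    have := pt_nonneg D x; have := mw_pos D α x; have : 0 < x := hx
    positivity
lemma aa_cont (D : GelfandData) (α : ℝ) : Continuous (aa D α) :=
  ((qt_cont D).mul continuous_id).mul (mw_cont D α)
lemma aa_nonneg (D : GelfandData) (α : ℝ) {t : ℝ} (ht : 0 ≤ t) : 0 ≤ aa D α t :=
  mul_nonneg (mul_nonneg (qt_nonneg D t) ht) (mw_pos D α t).le
lemma PP_deriv (D : GelfandData) (α : ℝ) {h : ℝ → ℝ} (hh : Continuous h) (s : ℝ) :
    HasDerivAt (PP D α h) (aa D α s * h s) s := by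
  have hc : Continuous (fun t => aa D α t * h t) := (aa_cont D α).mul hh
  exact intervalIntegral.integral_hasDerivAt_right (hc.intervalIntegrable 0 s)
    (hc.stronglyMeasurableAtFilter _ _) hc.continuousAt
lemma PP_zero (D : GelfandData) (α : ℝ) (h : ℝ → ℝ) : PP D α h 0 = 0 := by simp [PP]
lemma PP_mono (D : GelfandData) (α : ℝ) {h k : ℝ → ℝ} (hh : Continuous h) (hk : Continuous k)
    {s : ℝ} (hs : 0 ≤ s) (hle : ∀ t ∈ Icc 0 s, h t ≤ k t) : PP D α h s ≤ PP D α k s := by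
  apply intervalIntegral.integral_mono_on hs
  · exact ((aa_cont D α).mul hh).intervalIntegrable _ _
  · exact ((aa_cont D α).mul hk).intervalIntegrable _ _
  · intro t ht
    exact mul_le_mul_of_nonneg_left (hle t ht) (aa_nonneg D α ht.1)
lemma QQ_mul (D : GelfandData) (α : ℝ) (h : ℝ → ℝ) (s : ℝ) :
    s * mw D α s * QQ D α h s = PP D α h s := by
  have hm := (mw_pos D α s).ne'
  unfold QQ PP
  have := intervalIntegral.smul_integral_comp_mul_left (a := 0) (b := 1)
    (fun t => aa D α t * h t) s
  rw [mul_zero, mul_one] at this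
  rw [← this]
  have e : ∀ τ : ℝ, aa D α (s*τ) * h (s*τ) =
      s * (qt D (s*τ) * mw D α (s*τ) * h (s*τ) * τ) := by
    intro τ; unfold aa; ring
  simp_rw [e]
  rw [intervalIntegral.integral_const_mul]
  field_simp
  simp [pow_two]
  try ring
lemma QQ_cont (D : GelfandData) (α : ℝ) {h : ℝ → ℝ} (hh : Continuous h) :
    Continuous (QQ D α h) := by
  have hq := qt_cont D
  have hm := mw_cont D α
  unfold QQ
  refine (continuous_id.mul ?_).div hm (fun s => (mw_pos D α s).ne')
  apply intervalIntegral.continuous_parametric_intervalIntegral_of_continuous'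
  unfold Function.uncurry
  fun_prop
lemma QQ_eq_div (D : GelfandData) (α : ℝ) (h : ℝ → ℝ) {s : ℝ} (hs : s ≠ 0) :
    QQ D α h s = PP D α h s / (s * mw D α s) := by
  have hm := (mw_pos D α s).ne'
  rw [← QQ_mul, mul_div_cancel_left₀ _ (mul_ne_zero hs hm)]
lemma QQ_zero (D : GelfandData) (α : ℝ) (h : ℝ → ℝ) : QQ D α h 0 = 0 := by simp [QQ]
lemma QQ_mono (D : GelfandData) (α : ℝ) {h k : ℝ → ℝ} (hh : Continuous h) (hk : Continuous k)
    {s : ℝ} (hs : 0 ≤ s) (hle : ∀ t ∈ Icc 0 s, h t ≤ k t) : QQ D α h s ≤ QQ D α k s := by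
  rcases hs.eq_or_lt with rfl | hs0
  · simp [QQ_zero]
  rw [QQ_eq_div _ _ _ hs0.ne', QQ_eq_div _ _ _ hs0.ne']
  have := mw_pos D α s
  have := PP_mono D α hh hk hs hle
  gcongr
lemma QQ_deriv (D : GelfandData) (α : ℝ) {h : ℝ → ℝ} (hh : Continuous h) {s : ℝ} (hs : 0 < s) :
    HasDerivAt (QQ D α h) (qt D s * h s - (1 / s + α * s * pt D s) * QQ D α h s) s := by
  have hm := (mw_pos D α s).ne'
  have h1 := (PP_deriv D α hh s).div ((hasDerivAt_id s).mul (mw_deriv D α s))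
    (by simpa using ⟨hs.ne', hm⟩)
  have h2 : HasDerivAt (fun x => PP D α h x / (x * mw D α x)) _ s := h1
  have h3 : QQ D α h =ᶠ[nhds s] (fun x => PP D α h x / (x * mw D α x)) := by
    filter_upwards [lt_mem_nhds hs] with x hx
    exact QQ_eq_div D α h (ne_of_gt hx)
  refine (h2.congr_of_eventuallyEq h3).congr_deriv ?_
  simp only [Pi.mul_apply, id]
  rw [QQ_eq_div _ _ _ hs.ne']
  unfold aa
  field_simp
lemma QQ_const (D : GelfandData) (α c : ℝ) (s : ℝ) :
    QQ D α (fun _ => c) s = c * QQ D α (fun _ => 1) s := by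
  unfold QQ
  have e : ∀ τ : ℝ, qt D (s*τ) * mw D α (s*τ) * c * τ =
      c * (qt D (s*τ) * mw D α (s*τ) * 1 * τ) := by intro τ; ring
  simp_rw [e]
  rw [intervalIntegral.integral_const_mul]
  ring
lemma QQ_nonneg (D : GelfandData) (α : ℝ) {h : ℝ → ℝ} (hh : Continuous h)
    {s : ℝ} (hs : 0 ≤ s) (h0 : ∀ t ∈ Icc 0 s, 0 ≤ h t) : 0 ≤ QQ D α h s := by
  have := QQ_mono D α (h := fun _ => 0) (k := h) continuous_const hh hs h0
  rwa [QQ_const, zero_mul] at this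
lemma PP_le_sq (D : GelfandData) {α : ℝ} (hα : 0 ≤ α) {s : ℝ} (hs : 0 ≤ s) :
    PP D α (fun _ => 1) s ≤ s ^ 2 * mw D α s := by
  have : PP D α (fun _ => 1) s ≤ ∫ t in (0:ℝ)..s, s * mw D α s := by
    apply intervalIntegral.integral_mono_on hs
    · exact ((aa_cont D α).mul continuous_const).intervalIntegrable _ _
    · exact intervalIntegrable_const
    · intro t ht
      have h1 := mw_mono D hα ht.1 hs ht.2
      have h2 := mw_pos D α t
      unfold aa
      rw [mul_one]
      have h3 : qt D t * t ≤ s := by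
        nlinarith [qt_le_one D t, qt_nonneg D t, ht.1, ht.2]
      exact mul_le_mul h3 h1 h2.le hs
  rw [intervalIntegral.integral_const] at this
  simp at this
  linarith
lemma QQ_le_self (D : GelfandData) {α : ℝ} (hα : 0 ≤ α) {s : ℝ} (hs : 0 ≤ s) :
    QQ D α (fun _ => 1) s ≤ s := by
  rcases hs.eq_or_lt with rfl | hs0
  · simp [QQ_zero]
  rw [QQ_eq_div _ _ _ hs0.ne']
  have := mw_pos D α s
  rw [div_le_iff₀ (by positivity)]
  have := PP_le_sq D hα hs
  linarith
noncomputable def FF (D : GelfandData) (A x : ℝ) : ℝ := ∫ s in (0:ℝ)..x, 1 / fh D A s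

lemma FF_deriv (D : GelfandData) {A : ℝ} (hA : 0 ≤ A) (x : ℝ) :
    HasDerivAt (FF D A) (1 / fh D A x) x := by
  have hc : Continuous (fun s => 1 / fh D A s) :=
    continuous_const.div (fh_cont D hA) (fun s => (fh_pos D hA s).ne')
  exact intervalIntegral.integral_hasDerivAt_right (hc.intervalIntegrable 0 x)
    (hc.stronglyMeasurableAtFilter _ _) hc.continuousAt
lemma FF_zero (D : GelfandData) (A : ℝ) : FF D A 0 = 0 := by simp [FF]
lemma FF_eq (D : GelfandData) {A : ℝ} (hA : 0 ≤ A) :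
    FF D A A = ∫ s in (0:ℝ)..A, 1 / D.f s := by
  unfold FF
  apply intervalIntegral.integral_congr
  intro s hs
  rw [uIcc_of_le hA] at hs
  simp only [fh_eq D hs]
lemma FF_le_K (D : GelfandData) {A : ℝ} (hA : 0 ≤ A) : FF D A A ≤ D.K := by
  rw [FF_eq D hA, D.K_def, intervalIntegral.integral_of_le hA]
  apply setIntegral_mono_set D.f_int
  · filter_upwards [ae_restrict_mem measurableSet_Ioi] with s hs
    have := D.f_pos s (le_of_lt hs)
    simp only [Pi.zero_apply]; positivity
  · exact Ioc_subset_Ioi_self.eventuallyLE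
lemma K_pos (D : GelfandData) : 0 < D.K := by
  have h1 := FF_le_K D (A := 1) zero_le_one
  have h2 : 0 < FF D 1 1 := by
    unfold FF
    have hc : Continuous (fun s => 1 / fh D 1 s) :=
      continuous_const.div (fh_cont D zero_le_one) (fun s => (fh_pos D zero_le_one s).ne')
    apply intervalIntegral.intervalIntegral_pos_of_pos (hc.intervalIntegrable _ _)
    · intro x; have := fh_pos D zero_le_one x; positivity
    · norm_num
  linarith

lemma solv_le (D : GelfandData) {α lam : ℝ} (hl : lam ∈ solvableSet D α) :
    lam * GG D α ≤ D.K := by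
  obtain ⟨hlam, u, hu1, hu2, hupos, hu0, hu1', heq⟩ := hl
  set v := derivWithin u (Icc 0 1) with hv
  have hI : UniqueDiffOn ℝ (Icc (0:ℝ) 1) := uniqueDiffOn_Icc zero_lt_one
  have hvc : ContinuousOn v (Icc 0 1) := hu1.continuousOn_derivWithin hI le_rfl
  have huc : ContinuousOn u (Icc 0 1) := hu1.continuousOn
  have hud : ∀ r ∈ Ioo (0:ℝ) 1, HasDerivAt u (v r) r := by
    intro r hr
    exact ((hu1.differentiableOn (by norm_num)) r (Ioo_subset_Icc_self hr)).hasDerivWithinAt.hasDerivAt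
      (Icc_mem_nhds hr.1 hr.2)
  have hvd : ∀ r ∈ Ioo (0:ℝ) 1, HasDerivAt v (derivWithin v (Ioo 0 1) r) r := by
    intro r hr
    have hd : DifferentiableOn ℝ (deriv u) (Ioo 0 1) := by
      have := (contDiffOn_succ_iff_deriv_of_isOpen (n := 1) (𝕜 := ℝ) (f := u) isOpen_Ioo).1
        (by simpa [one_add_one_eq_two] using hu2)
      exact this.2.2.differentiableOn (by norm_num)
    have hd2 : DifferentiableOn ℝ v (Ioo 0 1) :=
      hd.congr (fun x hx => (hud x hx).deriv.symm)
    exact (hd2 r hr).hasDerivWithinAt.hasDerivAt (Ioo_mem_nhds hr.1 hr.2)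
  have hunn : ∀ r ∈ Icc (0:ℝ) 1, 0 ≤ u r := by
    intro r hr
    rcases hr.2.eq_or_lt with h | h
    · rw [h, hu1']
    · exact (hupos r ⟨hr.1, h⟩).le
  -- derivative of r m v
  have hgd : ∀ r ∈ Ioo (0:ℝ) 1, HasDerivAt (fun r => r * mw D α r * v r)
      (-(lam * (aa D α r * D.f (u r)))) r := by
    intro r hr
    have h1 := ((hasDerivAt_id r).mul (mw_deriv D α r)).mul (hvd r hr)
    have h2 : HasDerivAt (fun r => r * mw D α r * v r) _ r := h1
    refine h2.congr_deriv ?_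
    have e := heq r hr
    have hr0 := hr.1.ne'
    have hrI := Ioo_subset_Icc_self hr
    rw [← pt_eq D hrI, ← qt_eq D hrI] at e
    have e2 : derivWithin v (Ioo 0 1) r =
      - (1 / r + α * r * pt D r) * v r - lam * qt D r * D.f (u r) := by linarith
    rw [e2]
    simp only [Pi.mul_apply, id]
    unfold aa
    field_simp
    ring
  have hgc : ContinuousOn (fun r => r * mw D α r * v r) (Icc 0 1) :=
    (continuous_id.mul (mw_cont D α)).continuousOn.mul hvc
  have hvneg : ∀ r ∈ Icc (0:ℝ) 1, v r ≤ 0 := by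
    intro r hr
    rcases hr.1.eq_or_lt with h | h
    · rw [← h, hu0]
    have ha : AntitoneOn (fun r => r * mw D α r * v r) (Icc 0 1) := by
      apply antitoneOn_of_deriv_nonpos (convex_Icc 0 1) hgc
      · rw [interior_Icc]
        exact fun x hx => (hgd x hx).differentiableAt.differentiableWithinAt
      · rw [interior_Icc]
        intro x hx
        rw [(hgd x hx).deriv]
        have := aa_nonneg D α hx.1.le
        have := D.f_pos _ (hunn x (Ioo_subset_Icc_self hx))
        have : 0 ≤ lam * (aa D α x * D.f (u x)) := by positivity
        linarith
    have h3 := ha (by simp) hr hr.1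
    simp only [zero_mul] at h3
    have := mw_pos D α r
    by_contra hc
    push Not at hc
    have : 0 < r * mw D α r * v r := by positivity
    linarith
  have hanti : AntitoneOn u (Icc 0 1) := by
    apply antitoneOn_of_deriv_nonpos (convex_Icc 0 1) huc
    · rw [interior_Icc]
      exact fun x hx => (hud x hx).differentiableAt.differentiableWithinAt
    · rw [interior_Icc]
      intro x hx
      rw [(hud x hx).deriv]
      exact hvneg x (Ioo_subset_Icc_self hx)
  -- key inequality
  have key : ∀ r ∈ Ioo (0:ℝ) 1, v r ≤ - (lam * D.f (u r) * QQ D α (fun _ => 1) r) := by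
    intro r hr
    have hrI := Ioo_subset_Icc_self hr
    have hsub : Icc 0 r ⊆ Icc (0:ℝ) 1 := Icc_subset_Icc_right hr.2.le
    have hd : ∀ x ∈ Ioo 0 r, HasDerivAt
        (fun x => x * mw D α x * v x + lam * D.f (u r) * PP D α (fun _ => 1) x)
        (-(lam * (aa D α x * D.f (u x))) + lam * D.f (u r) * (aa D α x * 1)) x := by
      intro x hx
      exact (hgd x ⟨hx.1, hx.2.trans hr.2⟩).add ((PP_deriv D α continuous_const x).const_mul _)
    have hPc : Continuous (PP D α (fun _ => 1)) :=
      continuous_iff_continuousAt.2 fun x => (PP_deriv D α continuous_const x).continuousAt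
    have ha : AntitoneOn (fun x => x * mw D α x * v x + lam * D.f (u r) * PP D α (fun _ => 1) x)
        (Icc 0 r) := by
      apply antitoneOn_of_deriv_nonpos (convex_Icc 0 r)
      · exact (hgc.mono hsub).add (continuous_const.mul hPc).continuousOn
      · rw [interior_Icc]
        exact fun x hx => (hd x hx).differentiableAt.differentiableWithinAt
      · rw [interior_Icc]
        intro x hx
        rw [(hd x hx).deriv]
        have h1 := aa_nonneg D α hx.1.le
        have hxI := hsub (Ioo_subset_Icc_self hx)
        have h2 := D.f_mono (hunn r hrI) (hunn x hxI) (hanti hxI hrI hx.2.le)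
        have : 0 ≤ lam * (aa D α x * (D.f (u x) - D.f (u r))) := by
          have := sub_nonneg.2 h2
          positivity
        linarith
    have h3 := ha (left_mem_Icc.2 hr.1.le) (right_mem_Icc.2 hr.1.le) hr.1.le
    simp only [zero_mul, PP_zero, mul_zero, add_zero] at h3
    rw [← QQ_mul] at h3
    have hp : 0 < r * mw D α r := mul_pos hr.1 (mw_pos D α r)
    have h4 : r * mw D α r * (v r + lam * D.f (u r) * QQ D α (fun _ => 1) r) ≤ 0 := by linarith
    have := nonpos_of_mul_nonpos_right h4 hp
    linarith
  have hA : 0 ≤ u 0 := hunn 0 (by simp)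
  have hQc : Continuous (QQ D α (fun _ => 1)) := QQ_cont D α continuous_const
  have hd : ∀ r ∈ Ioo (0:ℝ) 1, HasDerivAt
      (fun r => FF D (u 0) (u r) + lam * ∫ s in (0:ℝ)..r, QQ D α (fun _ => 1) s)
      (1 / fh D (u 0) (u r) * v r + lam * QQ D α (fun _ => 1) r) r := by
    intro r hr
    exact ((FF_deriv D hA (u r)).comp r (hud r hr)).add
      ((intervalIntegral.integral_hasDerivAt_right (hQc.intervalIntegrable 0 r)
        (hQc.stronglyMeasurableAtFilter _ _) hQc.continuousAt).const_mul _)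
  have ha : AntitoneOn (fun r => FF D (u 0) (u r) + lam * ∫ s in (0:ℝ)..r, QQ D α (fun _ => 1) s)
      (Icc 0 1) := by
    apply antitoneOn_of_deriv_nonpos (convex_Icc 0 1)
    · apply ContinuousOn.add
      · have hFc : Continuous (FF D (u 0)) :=
          continuous_iff_continuousAt.2 fun x => (FF_deriv D hA x).continuousAt
        exact hFc.comp_continuousOn huc
      · exact (continuous_const.mul
          (intervalIntegral.continuous_primitive (fun a b => hQc.intervalIntegrable a b) 0)).continuousOn
    · rw [interior_Icc]
      exact fun x hx => (hd x hx).differentiableAt.differentiableWithinAt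
    · rw [interior_Icc]
      intro x hx
      rw [(hd x hx).deriv]
      have hxI := Ioo_subset_Icc_self hx
      rw [fh_eq D ⟨hunn x hxI, hanti (by simp) hxI hxI.1⟩]
      have hf := D.f_pos _ (hunn x hxI)
      have h1 := key x hx
      have : 1 / D.f (u x) * v x ≤ 1 / D.f (u x) * - (lam * D.f (u x) * QQ D α (fun _ => 1) x) :=
        mul_le_mul_of_nonneg_left h1 (by positivity)
      have e : 1 / D.f (u x) * - (lam * D.f (u x) * QQ D α (fun _ => 1) x) =
        - (lam * QQ D α (fun _ => 1) x) := by field_simp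
      linarith
  have h5 := ha (by simp) (by simp) zero_le_one
  simp only [hu1', FF_zero, intervalIntegral.integral_same, mul_zero, add_zero, zero_add] at h5
  exact h5.trans (FF_le_K D hA)
lemma int_mw (D : GelfandData) {α : ℝ} (hα : 0 < α) (s : ℝ) :
    ∫ t in (0:ℝ)..s, pt D t * t * mw D α t = (mw D α s - 1) / α := by
  have hc : Continuous (fun t => pt D t * t * mw D α t) :=
    ((pt_cont D).mul continuous_id).mul (mw_cont D α)
  have := intervalIntegral.integral_eq_sub_of_hasDerivAt (a := 0) (b := s)
    (f := fun t => mw D α t / α) (f' := fun t => pt D t * t * mw D α t)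
    (fun x _ => ((mw_deriv D α x).div_const α).congr_deriv (by field_simp))
    (hc.intervalIntegrable _ _)
  rw [this, mw_zero]; ring
lemma Q1_le (D : GelfandData) {α c s : ℝ} (hα : 0 < α) (hs : 0 < s) (hc : 0 ≤ c)
    (h : ∀ t ∈ Icc 0 s, qt D t ≤ c * pt D t) : QQ D α (fun _ => 1) s ≤ c / (α * s) := by
  have hm := mw_pos D α s
  have h1 : PP D α (fun _ => 1) s ≤ ∫ t in (0:ℝ)..s, c * (pt D t * t * mw D α t) := by
    apply intervalIntegral.integral_mono_on hs.le
    · exact ((aa_cont D α).mul continuous_const).intervalIntegrable _ _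
    · exact (continuous_const.mul
        (((pt_cont D).mul continuous_id).mul (mw_cont D α))).intervalIntegrable _ _
    · intro t ht
      have := mul_le_mul_of_nonneg_right (h t ht) (mul_nonneg ht.1 (mw_pos D α t).le)
      unfold aa
      linarith
  rw [intervalIntegral.integral_const_mul, int_mw D hα] at h1
  rw [QQ_eq_div _ _ _ hs.ne', div_le_div_iff₀ (by positivity) (by positivity)]
  have h2 : c * ((mw D α s - 1) / α) * (α * s) = c * (mw D α s - 1) * s := by field_simp
  have h3 := mul_le_mul_of_nonneg_right h1 (by positivity : 0 ≤ α * s)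
  nlinarith [mul_nonneg hc hs.le]
lemma Q1_ge (D : GelfandData) {α c s : ℝ} (hα : 0 < α) (hs : 0 < s)
    (h : ∀ t ∈ Icc 0 s, c * pt D t ≤ qt D t) :
    c * (1 - 1 / mw D α s) / (α * s) ≤ QQ D α (fun _ => 1) s := by
  have hm := mw_pos D α s
  have h1 : ∫ t in (0:ℝ)..s, c * (pt D t * t * mw D α t) ≤ PP D α (fun _ => 1) s := by
    apply intervalIntegral.integral_mono_on hs.le
    · exact (continuous_const.mul
        (((pt_cont D).mul continuous_id).mul (mw_cont D α))).intervalIntegrable _ _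
    · exact ((aa_cont D α).mul continuous_const).intervalIntegrable _ _
    · intro t ht
      have := mul_le_mul_of_nonneg_right (h t ht) (mul_nonneg ht.1 (mw_pos D α t).le)
      unfold aa
      linarith
  rw [intervalIntegral.integral_const_mul, int_mw D hα] at h1
  rw [QQ_eq_div _ _ _ hs.ne']
  have e : c * (1 - 1 / mw D α s) / (α * s) =
    (c * ((mw D α s - 1) / α)) / (s * mw D α s) := by field_simp
  rw [e]
  gcongr
lemma Q1_nonneg (D : GelfandData) (α : ℝ) {s : ℝ} (hs : 0 ≤ s) :
    0 ≤ QQ D α (fun _ => 1) s :=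
  QQ_nonneg D α continuous_const hs (fun _ _ => zero_le_one)
lemma Q1_cont (D : GelfandData) (α : ℝ) : Continuous (QQ D α (fun _ => 1)) :=
  QQ_cont D α continuous_const
lemma exists_delta (D : GelfandData) {ε : ℝ} (hε : 0 < ε) :
    ∃ δ, 0 < δ ∧ δ < 1 ∧ ∀ r ∈ Icc 0 δ, 1 - ε ≤ pt D r ∧ 1 - ε ≤ qt D r := by
  have h1 : ∀ᶠ r in nhds (0:ℝ), 1 - ε < pt D r :=
    (pt_cont D).continuousAt.eventually_const_lt (by rw [pt_zero]; linarith)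
  have h2 : ∀ᶠ r in nhds (0:ℝ), 1 - ε < qt D r :=
    (qt_cont D).continuousAt.eventually_const_lt (by rw [qt_zero]; linarith)
  obtain ⟨d, hd, H⟩ := Metric.eventually_nhds_iff.1 (h1.and h2)
  refine ⟨min (d/2) (1/2), by positivity, by linarith [min_le_right (d/2) (1/2:ℝ)], ?_⟩
  intro r hr
  have := H (y := r) (by
    rw [Real.dist_eq, sub_zero, abs_of_nonneg hr.1]
    linarith [hr.2, min_le_left (d/2) (1/2:ℝ)])
  exact ⟨this.1.le, this.2.le⟩
lemma M_ge_one (D : GelfandData) {s : ℝ} (hs : s ∈ Ico (0:ℝ) 1) : 1 ≤ D.M s := by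
  have := (D.M_def s hs).2 ⟨0, by simpa using hs.1, rfl⟩
  simpa [D.phi_zero, D.psi_zero] using this
lemma q_le_M (D : GelfandData) {s : ℝ} (hs : s ∈ Ico (0:ℝ) 1) :
    ∀ t ∈ Icc 0 s, qt D t ≤ D.M s * pt D t := by
  intro t ht
  have htI : t ∈ Ico (0:ℝ) 1 := ⟨ht.1, ht.2.trans_lt hs.2⟩
  have h1 := (D.M_def s hs).2 ⟨t, ht, rfl⟩
  rw [pt_eq D (Ico_subset_Icc_self htI), qt_eq D (Ico_subset_Icc_self htI)]
  have h2 := D.phi_pos t htI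
  simp only at h1
  rwa [div_le_iff₀ h2] at h1
lemma tail_le (D : GelfandData) {α δ : ℝ} (hα : 0 < α) (hδ : 0 < δ) (hδ1 : δ < 1) :
    ∫ s in δ..1, QQ D α (fun _ => 1) s ≤ (∫ s in Ioo (0:ℝ) 1, D.M s) / (α * δ) := by
  rw [intervalIntegral.integral_of_le hδ1.le, integral_Ioc_eq_integral_Ioo,
    ← integral_div]
  have hsub : Ioo δ 1 ⊆ Ioo 0 1 := Ioo_subset_Ioo_left hδ.le
  have hMi : IntegrableOn (fun s => D.M s / (α * δ)) (Ioo 0 1) := D.M_int.div_const _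
  calc ∫ s in Ioo δ 1, QQ D α (fun _ => 1) s ≤ ∫ s in Ioo δ 1, D.M s / (α * δ) := by
        apply setIntegral_mono_on _ (hMi.mono_set hsub) measurableSet_Ioo
        · intro s hs
          have hs0 : 0 < s := hδ.trans hs.1
          have hsI : s ∈ Ico (0:ℝ) 1 := ⟨hs0.le, hs.2⟩
          have hM := M_ge_one D hsI
          refine (Q1_le D hα hs0 (by linarith) (q_le_M D hsI)).trans ?_
          have := hs.1.le
          gcongr
        · exact ((Q1_cont D α).integrableOn_Icc (a := δ) (b := 1)).mono_set Ioo_subset_Icc_self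
    _ ≤ _ := by
        apply setIntegral_mono_set hMi
        · filter_upwards [ae_restrict_mem measurableSet_Ioo] with s hs
          have := M_ge_one D (Ioo_subset_Ico_self hs)
          simp only [Pi.zero_apply]; positivity
        · exact hsub.eventuallyLE
lemma int_inv (c b d : ℝ) (hb : 0 < b) (hd : b ≤ d) {α : ℝ} :
    ∫ s in b..d, c / (α * s) = c / α * Real.log (d / b) := by
  have e : ∀ s : ℝ, c / (α * s) = c / α * (1 / s) := by intro s; rw [div_mul_div_comm, mul_one]
  simp_rw [e]
  rw [intervalIntegral.integral_const_mul, integral_one_div_of_pos hb (hb.trans_le hd)]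
lemma intble_inv (c b d : ℝ) (hb : 0 < b) (hd : b ≤ d) {α : ℝ} (hα : 0 < α) :
    IntervalIntegrable (fun s => c / (α * s)) volume b d := by
  apply ContinuousOn.intervalIntegrable
  apply ContinuousOn.div continuousOn_const (by fun_prop)
  intro x hx
  rw [uIcc_of_le hd] at hx
  have := hb.trans_le hx.1
  positivity
lemma GG_upper (D : GelfandData) {ε : ℝ} (hε : 0 < ε) (hε1 : ε < 1) :
    ∃ C, ∀ᶠ α in atTop, 2 * α * GG D α ≤ 1 / (1 - ε) * Real.log α + C := by
  obtain ⟨δ, hδ, hδ1, hpq⟩ := exists_delta D hε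
  refine ⟨2 + 2 * ((∫ s in Ioo (0:ℝ) 1, D.M s) / δ), ?_⟩
  have hb : Tendsto (fun α : ℝ => 1 / √α) atTop (nhds 0) :=
    Tendsto.div_atTop tendsto_const_nhds Real.tendsto_sqrt_atTop
  filter_upwards [eventually_gt_atTop 0, hb.eventually_lt_const hδ] with α hα hbδ
  set b := 1 / √α with hbdef
  have hb0 : 0 < b := by positivity
  have hi : ∀ x y, IntervalIntegrable (QQ D α (fun _ => 1)) volume x y :=
    fun x y => (Q1_cont D α).intervalIntegrable x y
  have hG : GG D α = (∫ s in (0:ℝ)..b, QQ D α (fun _ => 1) s) +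
      (∫ s in b..δ, QQ D α (fun _ => 1) s) + ∫ s in δ..1, QQ D α (fun _ => 1) s := by
    rw [intervalIntegral.integral_add_adjacent_intervals (hi _ _) (hi _ _),
      intervalIntegral.integral_add_adjacent_intervals (hi _ _) (hi _ _)]; rfl
  have h1 : (∫ s in (0:ℝ)..b, QQ D α (fun _ => 1) s) ≤ 1 / α := by
    calc _ ≤ ∫ s in (0:ℝ)..b, b := by
          apply intervalIntegral.integral_mono_on hb0.le (hi _ _) intervalIntegrable_const
          intro x hx
          exact (QQ_le_self D hα.le hx.1).trans hx.2
      _ = 1 / α := by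
          rw [intervalIntegral.integral_const, hbdef]
          simp only [sub_zero, smul_eq_mul]
          rw [div_mul_div_comm, one_mul, Real.mul_self_sqrt hα.le]
  have h2 : (∫ s in b..δ, QQ D α (fun _ => 1) s) ≤ (1 / (1 - ε)) / α * (1 / 2 * Real.log α) := by
    have h1e : 0 < 1 - ε := by linarith
    calc _ ≤ ∫ s in b..δ, (1 / (1 - ε)) / (α * s) := by
          apply intervalIntegral.integral_mono_on hbδ.le (hi _ _) (intble_inv _ _ _ hb0 hbδ.le hα)
          intro x hx
          apply Q1_le D hα (hb0.trans_le hx.1) (by positivity)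
          intro t ht
          have := (hpq t ⟨ht.1, ht.2.trans hx.2⟩).1
          have h3 := qt_le_one D t
          rw [div_mul_eq_mul_div, one_mul, le_div_iff₀ h1e]
          have := qt_nonneg D t
          nlinarith
      _ = (1 / (1 - ε)) / α * Real.log (δ / b) := int_inv _ _ _ hb0 hbδ.le
      _ ≤ _ := by
          have : Real.log (δ / b) ≤ 1 / 2 * Real.log α := by
            rw [hbdef, div_div_eq_mul_div, div_one, Real.log_mul hδ.ne' (by positivity),
              Real.log_sqrt hα.le]
            have := Real.log_nonpos hδ.le hδ1.le
            linarith
          gcongr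
  have h3 := tail_le D hα hδ hδ1
  rw [hG]
  calc _ ≤ 2 * α * (1 / α + (1 / (1 - ε)) / α * (1 / 2 * Real.log α) +
        (∫ s in Ioo (0:ℝ) 1, D.M s) / (α * δ)) := by gcongr
    _ = _ := by
        have h1e : 1 - ε ≠ 0 := by linarith
        field_simp
        ring
lemma GG_lower (D : GelfandData) {ε : ℝ} (hε : 0 < ε) (hε1 : ε < 1) :
    ∃ C, ∀ᶠ α in atTop, (1 - ε) ^ 2 * Real.log α + C ≤ 2 * α * GG D α := by
  obtain ⟨δ, hδ, hδ1, hpq⟩ := exists_delta D hε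
  have h1e : 0 < 1 - ε := by linarith
  set R := √(2 / (ε * (1 - ε))) with hR
  have hR0 : 0 < R := by positivity
  refine ⟨2 * (1 - ε) ^ 2 * Real.log (δ / R), ?_⟩
  have hb : Tendsto (fun α : ℝ => R / √α) atTop (nhds 0) :=
    Tendsto.div_atTop tendsto_const_nhds Real.tendsto_sqrt_atTop
  filter_upwards [eventually_gt_atTop 0, hb.eventually_lt_const hδ] with α hα hbδ
  set b := R / √α with hbdef
  have hb0 : 0 < b := by positivity
  have hi : ∀ x y, IntervalIntegrable (QQ D α (fun _ => 1)) volume x y :=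
    fun x y => (Q1_cont D α).intervalIntegrable x y
  have hG : GG D α = (∫ s in (0:ℝ)..b, QQ D α (fun _ => 1) s) +
      (∫ s in b..δ, QQ D α (fun _ => 1) s) + ∫ s in δ..1, QQ D α (fun _ => 1) s := by
    rw [intervalIntegral.integral_add_adjacent_intervals (hi _ _) (hi _ _),
      intervalIntegral.integral_add_adjacent_intervals (hi _ _) (hi _ _)]; rfl
  have h1 : 0 ≤ (∫ s in (0:ℝ)..b, QQ D α (fun _ => 1) s) :=
    intervalIntegral.integral_nonneg hb0.le (fun x hx => Q1_nonneg D α hx.1)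
  have h3 : 0 ≤ (∫ s in δ..1, QQ D α (fun _ => 1) s) :=
    intervalIntegral.integral_nonneg hδ1.le (fun x hx => Q1_nonneg D α (hδ.le.trans hx.1))
  have hm : ∀ x ∈ Icc b δ, 1 / mw D α x ≤ ε := by
    intro x hx
    have hx0 : 0 < x := hb0.trans_le hx.1
    have i1 : (1 - ε) * (x ^ 2 / 2) ≤ ∫ s in (0:ℝ)..x, s * pt D s := by
      have : ∫ s in (0:ℝ)..x, (1 - ε) * s = (1 - ε) * (x ^ 2 / 2) := by
        rw [intervalIntegral.integral_const_mul, integral_id]; ring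
      rw [← this]
      apply intervalIntegral.integral_mono_on hx0.le
      · exact (by fun_prop : Continuous fun s : ℝ => (1 - ε) * s).intervalIntegrable _ _
      · exact (continuous_id.mul (pt_cont D)).intervalIntegrable _ _
      · intro s hs
        have := (hpq s ⟨hs.1, hs.2.trans hx.2⟩).1
        nlinarith [hs.1]
    have i2 : 1 / ε ≤ α * ∫ s in (0:ℝ)..x, s * pt D s := by
      have hx2 : b ^ 2 ≤ x ^ 2 := by have := hx.1; gcongr
      have hb2 : b ^ 2 = 2 / (ε * (1 - ε)) / α := by
        rw [hbdef, div_pow, Real.sq_sqrt hα.le, hR, Real.sq_sqrt (by positivity)]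
      calc 1 / ε = α * ((1 - ε) * (b ^ 2 / 2)) := by rw [hb2]; field_simp
        _ ≤ α * ((1 - ε) * (x ^ 2 / 2)) := by gcongr
        _ ≤ _ := by gcongr
    have i3 : 1 / ε ≤ mw D α x := by
      unfold mw
      have := Real.add_one_le_exp (α * ∫ s in (0:ℝ)..x, s * pt D s)
      linarith
    rw [div_le_iff₀ (mw_pos D α x)]
    rw [div_le_iff₀ hε] at i3
    linarith
  have h2 : (1 - ε) ^ 2 / α * (1 / 2 * Real.log α + Real.log (δ / R)) ≤
      (∫ s in b..δ, QQ D α (fun _ => 1) s) := by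
    calc _ = (1 - ε) ^ 2 / α * Real.log (δ / b) := by
          congr 1
          have : δ / b = √α * (δ / R) := by rw [hbdef]; field_simp
          rw [this, Real.log_mul (by positivity) (by positivity), Real.log_sqrt hα.le]
          ring
      _ = ∫ s in b..δ, (1 - ε) ^ 2 / (α * s) := (int_inv _ _ _ hb0 hbδ.le).symm
      _ ≤ _ := by
          apply intervalIntegral.integral_mono_on hbδ.le (intble_inv _ _ _ hb0 hbδ.le hα) (hi _ _)
          intro x hx
          have hx0 : 0 < x := hb0.trans_le hx.1
          refine le_trans ?_ (Q1_ge D (c := 1 - ε) hα hx0 ?_)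
          · have := hm x hx
            rw [pow_two]
            gcongr
          · intro t ht
            have h4 := (hpq t ⟨ht.1, ht.2.trans hx.2⟩).2
            have h5 := pt_le_one D t
            nlinarith
  rw [hG]
  calc _ = 2 * α * ((1 - ε) ^ 2 / α * (1 / 2 * Real.log α + Real.log (δ / R))) := by
        field_simp
    _ ≤ _ := by gcongr; linarith
lemma GG_asymp (D : GelfandData) :
    Tendsto (fun α => 2 * α * GG D α / Real.log α) atTop (nhds 1) := by
  have hlog : ∀ C : ℝ, Tendsto (fun α : ℝ => C / Real.log α) atTop (nhds 0) := fun C =>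
    Tendsto.div_atTop tendsto_const_nhds Real.tendsto_log_atTop
  have hlp : ∀ᶠ α : ℝ in atTop, 0 < Real.log α := Real.tendsto_log_atTop.eventually_gt_atTop 0
  have near : ∀ (g : ℝ → ℝ), ContinuousAt g 0 → ∀ U ∈ nhds (g 0), ∃ ε, 0 < ε ∧ ε < 1 ∧ g ε ∈ U := by
    intro g hg U hU
    obtain ⟨d, hd, H⟩ := Metric.eventually_nhds_iff.1 (hg hU)
    refine ⟨min (d/2) (1/2), by positivity, by linarith [min_le_right (d/2) (1/2:ℝ)], ?_⟩
    apply H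
    rw [Real.dist_eq, sub_zero, abs_of_nonneg (by positivity)]
    linarith [min_le_left (d/2) (1/2:ℝ)]
  rw [tendsto_order]
  constructor
  · intro a ha
    obtain ⟨ε, h0, h1, h2⟩ := near (fun ε => (1 - ε) ^ 2) (by fun_prop) (Ioi a)
      (Ioi_mem_nhds (by simpa using ha))
    obtain ⟨C, hC⟩ := GG_lower D h0 h1
    have ht := (hlog C).const_add ((1 - ε) ^ 2)
    rw [add_zero] at ht
    filter_upwards [hC, hlp, ht.eventually_const_lt h2] with α h3 h4 h5
    refine h5.trans_le ?_
    rw [le_div_iff₀ h4, add_mul, div_mul_cancel₀ _ h4.ne']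
    exact h3
  · intro a ha
    obtain ⟨ε, h0, h1, h2⟩ := near (fun ε => 1 / (1 - ε))
      (by apply ContinuousAt.div (by fun_prop) (by fun_prop) (by norm_num)) (Iio a)
      (Iio_mem_nhds (by simpa using ha))
    obtain ⟨C, hC⟩ := GG_upper D h0 h1
    have ht := (hlog C).const_add (1 / (1 - ε))
    rw [add_zero] at ht
    filter_upwards [hC, hlp, ht.eventually_lt_const h2] with α h3 h4 h5
    refine lt_of_le_of_lt ?_ h5
    rw [div_le_iff₀ h4, add_mul, div_mul_cancel₀ _ h4.ne']
    exact h3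
lemma PP1_pos (D : GelfandData) {α s : ℝ} (hs : 0 < s) : 0 < PP D α (fun _ => 1) s := by
  obtain ⟨δ, hδ, hδ1, hpq⟩ := exists_delta D (ε := 1/2) (by norm_num)
  have hc : Continuous (fun t => aa D α t * 1) := (aa_cont D α).mul continuous_const
  have hi : ∀ x y, IntervalIntegrable (fun t => aa D α t * 1) volume x y :=
    fun x y => hc.intervalIntegrable x y
  have hmin : 0 < min s δ := lt_min hs hδ
  have h1 : 0 < ∫ t in (0:ℝ)..(min s δ), aa D α t * 1 := by
    apply intervalIntegral.intervalIntegral_pos_of_pos_on (hi _ _) _ hmin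
    intro x hx
    have h2 := (hpq x ⟨hx.1.le, hx.2.le.trans (min_le_right _ _)⟩).2
    have h3 : 0 < qt D x := by linarith
    have := mw_pos D α x
    have := hx.1
    unfold aa
    positivity
  have h2 : 0 ≤ ∫ t in (min s δ)..s, aa D α t * 1 := by
    apply intervalIntegral.integral_nonneg (min_le_left _ _)
    intro x hx
    rw [mul_one]
    exact aa_nonneg D α (hmin.le.trans hx.1)
  unfold PP
  rw [← intervalIntegral.integral_add_adjacent_intervals (hi 0 (min s δ)) (hi _ s)]
  linarith
lemma Q1_pos (D : GelfandData) {α s : ℝ} (hs : 0 < s) : 0 < QQ D α (fun _ => 1) s := by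
  rw [QQ_eq_div _ _ _ hs.ne']
  have := PP1_pos D (α := α) hs
  have := mw_pos D α s
  positivity

lemma sol_of_fixed (D : GelfandData) {A α lam : ℝ} (hA : 0 ≤ A) (hlam : 0 < lam)
    {u : ℝ → ℝ} (hu : Continuous u) (hub : ∀ r ∈ Icc (0:ℝ) 1, u r ≤ A)
    (hfix : ∀ r ∈ Icc (0:ℝ) 1, u r = lam * ∫ s in r..1, QQ D α (fun t => fh D A (u t)) s) :
    lam ∈ solvableSet D α := by
  set h : ℝ → ℝ := fun t => fh D A (u t) with hh
  have hhc : Continuous h := (fh_cont D hA).comp hu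
  have hQc := QQ_cont D α hhc
  set w : ℝ → ℝ := fun r => lam * ∫ s in r..1, QQ D α h s with hw
  have hQpos : ∀ s, 0 < s → 0 < QQ D α h s := by
    intro s hs
    have h1 := QQ_mono D α (h := fun _ => D.f 0) (k := h) continuous_const hhc hs.le
      (fun t _ => fh_ge D hA _)
    rw [QQ_const] at h1
    have := mul_pos (D.f_pos 0 le_rfl) (Q1_pos D (α := α) hs)
    linarith
  have hwd : ∀ r, HasDerivAt w (-(lam * QQ D α h r)) r := by
    intro r
    have := (intervalIntegral.integral_hasDerivAt_left (hQc.intervalIntegrable r 1)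
      (hQc.stronglyMeasurableAtFilter _ _) hQc.continuousAt).const_mul lam
    exact this.congr_deriv (by ring)
  have hwderiv : deriv w = fun r => -(lam * QQ D α h r) := funext fun r => (hwd r).deriv
  have hw1 : ContDiff ℝ 1 w := by
    rw [contDiff_one_iff_deriv]
    refine ⟨fun r => (hwd r).differentiableAt, ?_⟩
    rw [hwderiv]
    exact (continuous_const.mul hQc).neg
  have hPP1 : ContDiff ℝ 1 (PP D α h) := by
    rw [contDiff_one_iff_deriv]
    refine ⟨fun r => (PP_deriv D α hhc r).differentiableAt, ?_⟩
    rw [show deriv (PP D α h) = fun r => aa D α r * h r from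
      funext fun r => (PP_deriv D α hhc r).deriv]
    exact (aa_cont D α).mul hhc
  have hm1 : ContDiff ℝ 1 (mw D α) := by
    rw [contDiff_one_iff_deriv]
    refine ⟨fun r => (mw_deriv D α r).differentiableAt, ?_⟩
    rw [show deriv (mw D α) = fun r => α * (r * pt D r) * mw D α r from
      funext fun r => (mw_deriv D α r).deriv]
    exact (continuous_const.mul (continuous_id.mul (pt_cont D))).mul (mw_cont D α)
  have hQ1 : ContDiffOn ℝ 1 (QQ D α h) (Ioo 0 1) := by
    have h1 : ContDiffOn ℝ 1 (fun s => PP D α h s / (s * mw D α s)) (Ioo 0 1) := by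
      apply hPP1.contDiffOn.div (contDiff_id.mul hm1).contDiffOn
      intro x hx
      exact mul_ne_zero hx.1.ne' (mw_pos D α x).ne'
    exact h1.congr (fun x hx => QQ_eq_div D α h hx.1.ne')
  have hw2 : ContDiffOn ℝ 2 w (Ioo 0 1) := by
    have := (contDiffOn_succ_iff_deriv_of_isOpen (n := 1) (𝕜 := ℝ) (f := w)
      (isOpen_Ioo (a := (0:ℝ)) (b := 1))).2
      ⟨fun r _ => (hwd r).differentiableAt.differentiableWithinAt, by simp, by
        rw [hwderiv]
        exact (contDiffOn_const.mul hQ1).neg⟩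
    simpa [one_add_one_eq_two] using this
  have hwpos : ∀ r ∈ Ico (0:ℝ) 1, 0 < w r := by
    intro r hr
    apply mul_pos hlam
    apply intervalIntegral.intervalIntegral_pos_of_pos_on (hQc.intervalIntegrable _ _) _ hr.2
    intro x hx
    exact hQpos x (hr.1.trans_lt hx.1)
  have hdw : ∀ r ∈ Icc (0:ℝ) 1, derivWithin w (Icc 0 1) r = -(lam * QQ D α h r) := by
    intro r hr
    exact (hwd r).hasDerivWithinAt.derivWithin (uniqueDiffOn_Icc zero_lt_one r hr)
  refine ⟨hlam, w, hw1.contDiffOn, hw2, hwpos, ?_, ?_, ?_⟩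
  · rw [hdw 0 (by simp), QQ_zero]; simp
  · simp [hw]
  · intro r hr
    have hrI := Ioo_subset_Icc_self hr
    have e1 : derivWithin (derivWithin w (Icc 0 1)) (Ioo 0 1) r =
        -(lam * (qt D r * h r - (1 / r + α * r * pt D r) * QQ D α h r)) := by
      rw [derivWithin_congr (fun x hx => hdw x (Ioo_subset_Icc_self hx)) (hdw r hrI)]
      exact ((QQ_deriv D α hhc hr.1).const_mul lam).neg.hasDerivWithinAt.derivWithin
        (isOpen_Ioo.uniqueDiffWithinAt hr)
    have e2 : h r = D.f (w r) := by
      have : w r = u r := (hfix r hrI).symm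
      rw [this, hh]
      refine fh_eq D ⟨?_, hub r hrI⟩
      rw [← this]
      exact (hwpos r ⟨hr.1.le, hr.2⟩).le
    rw [e1, hdw r hrI, ← e2, pt_eq D hrI, qt_eq D hrI]
    ring

noncomputable def TT (D : GelfandData) (A α lam : ℝ) (u : ℝ → ℝ) (r : ℝ) : ℝ :=
  lam * ∫ s in (clampI 1 r)..1, QQ D α (fun t => fh D A (u t)) s

lemma TT_cont (D : GelfandData) {A : ℝ} (hA : 0 ≤ A) (α lam : ℝ) {u : ℝ → ℝ} (hu : Continuous u) :
    Continuous (TT D A α lam u) := by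
  have hQc := QQ_cont D α ((fh_cont D hA).comp hu)
  have h1 : Continuous (fun r => ∫ s in r..1, QQ D α (fun t => fh D A (u t)) s) := by
    have : (fun r => ∫ s in r..1, QQ D α (fun t => fh D A (u t)) s) =
      fun r => - ∫ s in (1:ℝ)..r, QQ D α (fun t => fh D A (u t)) s :=
      funext fun r => intervalIntegral.integral_symm _ _
    rw [this]
    exact (intervalIntegral.continuous_primitive (fun a b => hQc.intervalIntegrable a b) 1).neg
  exact continuous_const.mul (h1.comp (clampI_cont 1))
lemma QQfh_bound (D : GelfandData) {A α : ℝ} (hA : 0 ≤ A) (hα : 0 ≤ α) {u : ℝ → ℝ}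
    (hu : Continuous u) {s : ℝ} (hs : s ∈ Icc (0:ℝ) 1) :
    |QQ D α (fun t => fh D A (u t)) s| ≤ D.f A := by
  have hc : Continuous (fun t => fh D A (u t)) := (fh_cont D hA).comp hu
  rw [abs_of_nonneg (QQ_nonneg D α hc hs.1 (fun t _ => (fh_pos D hA _).le))]
  have h1 := QQ_mono D α hc (k := fun _ => D.f A) continuous_const hs.1 (fun t _ => fh_le D hA _)
  rw [QQ_const] at h1
  have h2 := QQ_le_self D hα hs.1
  have h3 := D.f_pos A hA
  nlinarith [hs.2]
lemma TT_mono (D : GelfandData) {A α lam : ℝ} (hA : 0 ≤ A) (hlam : 0 < lam) {u v : ℝ → ℝ}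
    (hu : Continuous u) (hv : Continuous v) (huv : ∀ t ∈ Icc (0:ℝ) 1, u t ≤ v t) (r : ℝ) :
    TT D A α lam u r ≤ TT D A α lam v r := by
  have hcu : Continuous (fun t => fh D A (u t)) := (fh_cont D hA).comp hu
  have hcv : Continuous (fun t => fh D A (v t)) := (fh_cont D hA).comp hv
  have hr := clampI_mem zero_le_one r
  unfold TT
  refine mul_le_mul_of_nonneg_left ?_ hlam.le
  apply intervalIntegral.integral_mono_on hr.2 ((QQ_cont D α hcu).intervalIntegrable _ _)
    ((QQ_cont D α hcv).intervalIntegrable _ _)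
  intro s hs
  apply QQ_mono D α hcu hcv (hr.1.trans hs.1)
  intro t ht
  exact fh_mono D hA (huv t ⟨ht.1, ht.2.trans hs.2⟩)
lemma TT_lip (D : GelfandData) {A α lam : ℝ} (hA : 0 ≤ A) (hα : 0 ≤ α) (hlam : 0 < lam) {u : ℝ → ℝ}
    (hu : Continuous u) (x y : ℝ) :
    dist (TT D A α lam u x) (TT D A α lam u y) ≤ (lam * D.f A) * dist x y := by
  have hcu : Continuous (fun t => fh D A (u t)) := (fh_cont D hA).comp hu
  have hi : ∀ a b, IntervalIntegrable (QQ D α (fun t => fh D A (u t))) volume a b :=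
    fun a b => (QQ_cont D α hcu).intervalIntegrable a b
  unfold TT
  rw [Real.dist_eq, ← mul_sub, abs_mul, abs_of_pos hlam, mul_assoc]
  have hx := clampI_mem zero_le_one x
  have hy := clampI_mem zero_le_one y
  have e : (∫ s in (clampI 1 x)..1, QQ D α (fun t => fh D A (u t)) s) -
      ∫ s in (clampI 1 y)..1, QQ D α (fun t => fh D A (u t)) s =
      ∫ s in (clampI 1 x)..(clampI 1 y), QQ D α (fun t => fh D A (u t)) s := by
    rw [← intervalIntegral.integral_add_adjacent_intervals (hi (clampI 1 x) (clampI 1 y))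
      (hi (clampI 1 y) 1)]
    ring
  have h1 := intervalIntegral.norm_integral_le_of_norm_le_const (a := clampI 1 x)
    (b := clampI 1 y) (C := D.f A) (f := QQ D α (fun t => fh D A (u t))) (by
      intro s hs
      apply QQfh_bound D hA hα hu
      have := uIoc_subset_uIcc hs
      exact uIcc_subset_Icc hx hy this)
  rw [e]
  rw [Real.norm_eq_abs] at h1
  refine mul_le_mul_of_nonneg_left (h1.trans ?_) hlam.le
  refine mul_le_mul_of_nonneg_left ?_ (D.f_pos A hA).le
  rw [Real.dist_eq]
  rcases le_total x y with h | h
  · rw [abs_of_nonneg (sub_nonneg.2 (clampI_mono 1 h)), abs_sub_comm,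
      abs_of_nonneg (sub_nonneg.2 h)]
    exact clampI_lip 1 h
  · rw [abs_sub_comm, abs_of_nonneg (sub_nonneg.2 (clampI_mono 1 h)),
      abs_of_nonneg (sub_nonneg.2 h)]
    exact clampI_lip 1 h
lemma TT_tendsto (D : GelfandData) {A α lam : ℝ} (hA : 0 ≤ A) (hα : 0 ≤ α)
    {U : ℕ → ℝ → ℝ} {u : ℝ → ℝ} (hU : ∀ n, Continuous (U n))
    (h : ∀ r, Tendsto (fun n => U n r) atTop (nhds (u r))) (r : ℝ) :
    Tendsto (fun n => TT D A α lam (U n) r) atTop (nhds (TT D A α lam u r)) := by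
  have hcU : ∀ n, Continuous (fun t => fh D A (U n t)) := fun n => (fh_cont D hA).comp (hU n)
  have hr := clampI_mem zero_le_one r
  unfold TT
  apply Tendsto.const_mul
  apply intervalIntegral.tendsto_integral_filter_of_dominated_convergence (fun _ => D.f A)
  · exact Eventually.of_forall fun n => (QQ_cont D α (hcU n)).aestronglyMeasurable
  · refine Eventually.of_forall fun n => Eventually.of_forall fun s hs => ?_
    rw [uIoc_of_le hr.2] at hs
    exact QQfh_bound D hA hα (hU n) ⟨hr.1.trans hs.1.le, hs.2⟩
  · exact intervalIntegrable_const
  · refine Eventually.of_forall fun s hs => ?_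
    unfold QQ
    apply Tendsto.div_const
    apply Tendsto.const_mul
    apply intervalIntegral.tendsto_integral_filter_of_dominated_convergence
      (fun τ => mw D α (s * τ) * D.f A)
    · refine Eventually.of_forall fun n => Continuous.aestronglyMeasurable ?_
      have := qt_cont D; have := mw_cont D α; have := hcU n; have := fh_cont D hA; have := hU n
      fun_prop
    · refine Eventually.of_forall fun n => Eventually.of_forall fun τ hτ => ?_
      rw [uIoc_of_le zero_le_one] at hτ
      have h1 := qt_nonneg D (s * τ); have h2 := qt_le_one D (s * τ)
      have h3 := mw_pos D α (s * τ)
      have h4 := fh_pos D hA (U n (s * τ)); have h5 := fh_le D hA (U n (s * τ))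
      have h6 := hτ.1
      rw [Real.norm_of_nonneg (by positivity)]
      calc _ ≤ 1 * mw D α (s * τ) * D.f A * 1 := by
            have := D.f_pos A hA
            gcongr
            exact hτ.2
        _ = _ := by ring
    · have := mw_cont D α
      exact (by fun_prop : Continuous fun τ => mw D α (s * τ) * D.f A).intervalIntegrable _ _
    · refine Eventually.of_forall fun τ _ => ?_
      apply Tendsto.mul_const
      apply Tendsto.const_mul
      exact ((fh_cont D hA).tendsto _).comp (h _)

lemma exists_sol (D : GelfandData) {A α lam : ℝ} (hA : 0 ≤ A) (hα : 0 ≤ α) (hlam : 0 < lam)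
    {v : ℝ → ℝ} (hv : Continuous v) (hv0 : ∀ r ∈ Icc (0:ℝ) 1, 0 ≤ v r)
    (hvA : ∀ r ∈ Icc (0:ℝ) 1, v r ≤ A)
    (hsup : ∀ r ∈ Icc (0:ℝ) 1, TT D A α lam v r ≤ v r) : lam ∈ solvableSet D α := by
  set U : ℕ → ℝ → ℝ := fun n => (TT D A α lam)^[n] (fun _ => 0) with hUdef
  have hUs : ∀ n, U (n+1) = TT D A α lam (U n) := fun n => Function.iterate_succ_apply' _ _ _
  have hUc : ∀ n, Continuous (U n) := by
    intro n
    induction n with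
    | zero => exact continuous_const
    | succ n ih => rw [hUs]; exact TT_cont D hA α lam ih
  have hcl : ∀ (w : ℝ → ℝ) r, TT D A α lam w (clampI 1 r) = TT D A α lam w r := by
    intro w r
    unfold TT
    rw [clampI_eq (clampI_mem zero_le_one r)]
  have hUmono : ∀ n r, U n r ≤ U (n+1) r := by
    intro n
    induction n with
    | zero =>
      intro r
      rw [hUs]
      have hr := clampI_mem zero_le_one r
      have : 0 ≤ TT D A α lam (U 0) r := by
        apply mul_nonneg hlam.le
        apply intervalIntegral.integral_nonneg hr.2
        intro s hs
        exact QQ_nonneg D α ((fh_cont D hA).comp (hUc 0)) (hr.1.trans hs.1)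
          (fun t _ => (fh_pos D hA _).le)
      exact this
    | succ n ih =>
      intro r
      rw [hUs, hUs (n+1)]
      exact TT_mono D hA hlam (hUc n) (hUc (n+1)) (fun t _ => ih t) r
  have hUv : ∀ n r, U n r ≤ v (clampI 1 r) := by
    intro n
    induction n with
    | zero => intro r; exact hv0 _ (clampI_mem zero_le_one r)
    | succ n ih =>
      intro r
      rw [hUs]
      have h1 := TT_mono D (α := α) hA hlam (hUc n) hv (fun t ht => by
        have := ih t
        rwa [clampI_eq ht] at this) r
      have h2 := hsup _ (clampI_mem zero_le_one r)
      rw [hcl] at h2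
      exact h1.trans h2
  set u : ℝ → ℝ := fun r => ⨆ n, U n r with hu
  have hbdd : ∀ r, BddAbove (range fun n => U n r) := by
    intro r; refine ⟨v (clampI 1 r), ?_⟩
    rintro _ ⟨n, rfl⟩
    exact hUv n r
  have hlim : ∀ r, Tendsto (fun n => U n r) atTop (nhds (u r)) := fun r =>
    tendsto_atTop_ciSup (monotone_nat_of_le_succ fun n => hUmono n r) (hbdd r)
  have huc : Continuous u := by
    have : ∀ x y, dist (u x) (u y) ≤ (lam * D.f A) * dist x y := by
      intro x y
      have h1 : Tendsto (fun n => dist (U (n+1) x) (U (n+1) y)) atTop (nhds (dist (u x) (u y))) :=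
        (((hlim x).comp (tendsto_add_atTop_nat 1)).dist ((hlim y).comp (tendsto_add_atTop_nat 1)))
      refine le_of_tendsto' h1 fun n => ?_
      rw [hUs]
      exact TT_lip D hA hα hlam (hUc n) x y
    exact (LipschitzWith.of_dist_le' this).continuous
  have hfix : ∀ r, u r = TT D A α lam u r := by
    intro r
    have h1 := TT_tendsto D (lam := lam) hA hα hUc hlim r
    have h2 : Tendsto (fun n => U (n+1) r) atTop (nhds (u r)) :=
      (hlim r).comp (tendsto_add_atTop_nat 1)
    simp_rw [hUs] at h2
    exact tendsto_nhds_unique h2 h1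
  apply sol_of_fixed D hA hlam huc
  · intro r hr
    refine ciSup_le fun n => ?_
    have := hUv n r
    rw [clampI_eq hr] at this
    exact this.trans (hvA r hr)
  · intro r hr
    have := hfix r
    unfold TT at this
    rwa [clampI_eq hr] at this
lemma exists_inv (D : GelfandData) {A : ℝ} (hA : 0 ≤ A) :
    ∃ g : ℝ → ℝ, StrictMono g ∧ (∀ x, g (FF D A x) = x) ∧
      (∀ y, HasDerivAt g (fh D A (g y)) y) := by
  have hFc : Continuous (FF D A) :=
    continuous_iff_continuousAt.2 fun x => (FF_deriv D hA x).continuousAt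
  have hsm : StrictMono (FF D A) := by
    apply strictMono_of_deriv_pos
    intro x
    rw [(FF_deriv D hA x).deriv]
    have := fh_pos D hA x
    positivity
  have hfA := D.f_pos A hA
  -- F x - x / f A is monotone
  have hm : Monotone (fun x => FF D A x - x / D.f A) := by
    have hd : ∀ x, HasDerivAt (fun x => FF D A x - x / D.f A) (1 / fh D A x - 1 / D.f A) x :=
      fun x => (FF_deriv D hA x).sub ((hasDerivAt_id x).div_const _)
    apply monotone_of_deriv_nonneg (fun x => (hd x).differentiableAt)
    intro x
    rw [(hd x).deriv, sub_nonneg]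
    exact one_div_le_one_div_of_le (fh_pos D hA x) (fh_le D hA x)
  have hsurj : Function.Surjective (FF D A) := by
    apply hFc.surjective
    · apply tendsto_atTop_mono' _ _ (tendsto_id.atTop_div_const hfA)
      filter_upwards [eventually_ge_atTop 0] with x hx
      have := hm hx
      simp [FF_zero] at this
      exact this
    · apply tendsto_atBot_mono' _ _ (tendsto_id.atBot_div_const hfA)
      filter_upwards [eventually_le_atBot 0] with x hx
      have := hm hx
      simp [FF_zero] at this
      exact this
  let e := hsm.orderIsoOfSurjective _ hsurj
  refine ⟨e.symm, e.symm.strictMono, fun x => e.symm_apply_apply x, fun y => ?_⟩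
  have h1 : HasDerivAt (FF D A) (1 / fh D A (e.symm y)) (e.symm y) := FF_deriv D hA _
  have h2 := HasDerivAt.of_local_left_inverse (f := FF D A) (g := e.symm) (a := y)
    e.symm.continuous.continuousAt h1 (by have := fh_pos D hA (e.symm y); positivity)
    (Eventually.of_forall fun z => e.apply_symm_apply z)
  simpa using h2

lemma E_bound (D : GelfandData) {α lam δ η C : ℝ} (hα : 0 < α) (hlam : 0 < lam)
    (hδ : 0 < δ) (hδ1 : δ < 1)
    (hpq : ∀ r ∈ Icc 0 δ, 1 - 1/2 ≤ pt D r ∧ 1 - 1/2 ≤ qt D r)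
    (hC : C = ∫ s in Ioo (0:ℝ) 1, D.M s)
    (h1 : lam / α * 4 ≤ η) (h2 : lam / α * (C / δ) ≤ η)
    {W : ℝ → ℝ} (hW : ∀ r, HasDerivAt W (-(lam * QQ D α (fun _ => 1) r)) r)
    {r : ℝ} (hr : r ∈ Icc (0:ℝ) 1) :
    PP D α W r - PP D α (fun _ => 1) r * W r ≤ 2 * η * PP D α (fun _ => 1) r := by
  have hWc : Continuous W := continuous_iff_continuousAt.2 fun x => (hW x).continuousAt
  set N := PP D α (fun _ => 1) with hN
  set Q := QQ D α (fun _ => 1) with hQ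
  have hNd : ∀ x, HasDerivAt N (aa D α x) x := fun x =>
    (PP_deriv D α continuous_const x).congr_deriv (mul_one _)
  have hQc : Continuous Q := Q1_cont D α
  have hη : 0 ≤ η := le_trans (by positivity) h1
  have hEd : ∀ x, HasDerivAt (fun r => PP D α W r - N r * W r) (lam * (N x * Q x)) x := by
    intro x
    exact ((PP_deriv D α hWc x).sub ((hNd x).mul (hW x))).congr_deriv (by ring)
  have hNmono : MonotoneOn N (Ici 0) := by
    apply monotoneOn_of_deriv_nonneg (convex_Ici 0)
    · exact fun x _ => (hNd x).continuousAt.continuousWithinAt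
    · exact fun x _ => (hNd x).differentiableAt.differentiableWithinAt
    · intro x hx
      rw [interior_Ici] at hx
      rw [(hNd x).deriv]
      exact aa_nonneg D α (le_of_lt hx)
  have hN0 : N 0 = 0 := PP_zero D α _
  have hNnn : ∀ x, 0 ≤ x → 0 ≤ N x := fun x hx => by
    rw [← hN0]; exact hNmono self_mem_Ici hx hx
  have first : ∀ x ∈ Icc 0 δ, PP D α W x - N x * W x ≤ η * N x := by
    intro x hx
    have hd : ∀ x, HasDerivAt (fun r => η * N r - (PP D α W r - N r * W r))
        (η * aa D α x - lam * (N x * Q x)) x := fun x => ((hNd x).const_mul η).sub (hEd x)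
    have hmon : MonotoneOn (fun r => η * N r - (PP D α W r - N r * W r)) (Icc 0 δ) := by
      apply monotoneOn_of_deriv_nonneg (convex_Icc 0 δ)
      · exact fun x _ => (hd x).continuousAt.continuousWithinAt
      · exact fun x _ => (hd x).differentiableAt.differentiableWithinAt
      · intro y hy
        rw [interior_Icc] at hy
        rw [(hd y).deriv, sub_nonneg]
        have hm := mw_pos D α y
        have hy0 := hy.1
        have hQ1 : Q y ≤ y := QQ_le_self D hα.le hy0.le
        have hQ0 : 0 ≤ Q y := Q1_nonneg D α hy0.le
        have hQ2 : Q y ≤ 2 / (α * y) := by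
          apply Q1_le D hα hy0 (by norm_num)
          intro t ht
          have := (hpq t ⟨ht.1, ht.2.trans hy.2.le⟩).1
          have := qt_le_one D t
          linarith
        have hQQ : Q y * Q y ≤ 2 / α := by
          calc Q y * Q y ≤ y * (2 / (α * y)) := by gcongr
            _ = 2 / α := by field_simp
        have hq := (hpq y ⟨hy0.le, hy.2.le⟩).2
        have hk : lam * (Q y * Q y) ≤ η * qt D y := by
          calc lam * (Q y * Q y) ≤ lam * (2 / α) := by gcongr
            _ = (lam / α * 4) * (1/2) := by ring
            _ ≤ η * qt D y := by
              apply mul_le_mul h1 (by linarith) (by norm_num) hη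
        have eN : N y = y * mw D α y * Q y := (QQ_mul D α _ y).symm
        rw [eN]
        unfold aa
        have := mul_le_mul_of_nonneg_right hk (by positivity : 0 ≤ y * mw D α y)
        nlinarith
    have := hmon (left_mem_Icc.2 hδ.le) hx hx.1
    simp only [hN0, PP_zero] at this
    linarith
  rcases le_total r δ with hrd | hrd
  · have := first r ⟨hr.1, hrd⟩
    nlinarith [hNnn r hr.1, mul_nonneg hη (hNnn r hr.1)]
  have hd : ∀ x, HasDerivAt (fun x => lam * N r * (∫ s in δ..x, Q s) - (PP D α W x - N x * W x))
      (lam * N r * Q x - lam * (N x * Q x)) x := fun x =>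
    ((intervalIntegral.integral_hasDerivAt_right (hQc.intervalIntegrable δ x)
        (hQc.stronglyMeasurableAtFilter _ _) hQc.continuousAt).const_mul _).sub (hEd x)
  have hmon : MonotoneOn (fun x => lam * N r * (∫ s in δ..x, Q s) - (PP D α W x - N x * W x))
      (Icc δ r) := by
    apply monotoneOn_of_deriv_nonneg (convex_Icc δ r)
    · exact fun x _ => (hd x).continuousAt.continuousWithinAt
    · exact fun x _ => (hd x).differentiableAt.differentiableWithinAt
    · intro y hy
      rw [interior_Icc] at hy
      rw [(hd y).deriv]
      have hy0 := hδ.trans hy.1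
      have hQ0 : 0 ≤ Q y := Q1_nonneg D α hy0.le
      have := hNmono hy0.le hr.1 hy.2.le
      have := mul_nonneg (mul_nonneg hlam.le hQ0) (sub_nonneg.2 this)
      linarith
  have h3 := hmon (left_mem_Icc.2 hrd) (right_mem_Icc.2 hrd) hrd
  simp only [intervalIntegral.integral_same, mul_zero] at h3
  have h4 := first δ ⟨hδ.le, le_rfl⟩
  have h5 : N δ ≤ N r := hNmono hδ.le hr.1 hrd
  have h6 : ∫ s in δ..r, Q s ≤ C / (α * δ) := by
    rw [hC]
    refine le_trans ?_ (tail_le D hα hδ hδ1)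
    rw [← intervalIntegral.integral_add_adjacent_intervals (hQc.intervalIntegrable δ r)
      (hQc.intervalIntegrable r 1)]
    have : 0 ≤ ∫ s in r..1, Q s :=
      intervalIntegral.integral_nonneg hr.2 fun x hx => Q1_nonneg D α (hr.1.trans hx.1)
    linarith
  have hNr := hNnn r hr.1
  have h7 : lam * N r * (∫ s in δ..r, Q s) ≤ η * N r := by
    calc _ ≤ lam * N r * (C / (α * δ)) := by gcongr
      _ = (lam / α * (C / δ)) * N r := by field_simp
      _ ≤ _ := by gcongr
  have h8 := mul_le_mul_of_nonneg_left h5 hη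
  linarith

lemma GG_pos (D : GelfandData) (α : ℝ) : 0 < GG D α := by
  apply intervalIntegral.intervalIntegral_pos_of_pos_on ((Q1_cont D α).intervalIntegrable _ _) _
    zero_lt_one
  intro x hx
  exact Q1_pos D hx.1

lemma exists_A (D : GelfandData) {c : ℝ} (hc : c < D.K) : ∃ A, 0 ≤ A ∧ c ≤ FF D A A := by
  have h := intervalIntegral_tendsto_integral_Ioi 0 D.f_int tendsto_id
  rw [← D.K_def] at h
  obtain ⟨A, h1, h2⟩ := ((h.eventually_const_lt hc).and (eventually_ge_atTop 0)).exists
  exact ⟨A, h2, by rw [FF_eq D h2]; exact h1.le⟩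

lemma aG_tendsto (D : GelfandData) : Tendsto (fun α => α * GG D α) atTop atTop := by
  have h := (GG_asymp D).pos_mul_atTop one_pos
    (Real.tendsto_log_atTop.atTop_div_const (two_pos : (0:ℝ) < 2))
  refine h.congr' ?_
  filter_upwards [Real.tendsto_log_atTop.eventually_gt_atTop 0] with α hα
  field_simp

lemma solv_ge (D : GelfandData) {ε : ℝ} (hε : 0 < ε) (hε1 : ε < 1) :
    ∀ᶠ α in atTop, (1 - ε) * D.K / GG D α ∈ solvableSet D α := by
  have hK := K_pos D
  obtain ⟨A, hA, hAK⟩ := exists_A D (c := (1 - ε ^ 2) * D.K) (by nlinarith [sq_pos_of_pos hε])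
  obtain ⟨g, hgm, hgF, hgd⟩ := exists_inv D hA
  obtain ⟨δ, hδ, hδ1, hpq⟩ := exists_delta D (ε := 1/2) (by norm_num)
  set S := D.f (A+1) - D.f A with hS
  have hS0 : 0 ≤ S := by
    have := D.f_mono (a := A) (b := A+1) hA (by simp; linarith) (by linarith)
    linarith
  have hfA := D.f_pos A hA
  have hf0 := D.f_pos 0 le_rfl
  set L := S * D.f A + 1 with hL
  have hL0 : 0 < L := by positivity
  set η := ε * D.f 0 / (2 * L) with hη
  have hη0 : 0 < η := by positivity
  set C := ∫ s in Ioo (0:ℝ) 1, D.M s with hC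
  have hgLip : ∀ x y, x ≤ y → g y - g x ≤ D.f A * (y - x) := by
    have hd : ∀ x, HasDerivAt (fun x => D.f A * x - g x) (D.f A * 1 - fh D A (g x)) x :=
      fun x => ((hasDerivAt_id x).const_mul _).sub (hgd x)
    have hm : Monotone (fun x => D.f A * x - g x) := by
      apply monotone_of_deriv_nonneg (fun x => (hd x).differentiableAt)
      intro x
      rw [(hd x).deriv]
      have := fh_le D hA (g x)
      linarith
    intro x y hxy
    have := hm hxy
    simp only at this
    linarith
  have hlim : ∀ c : ℝ, Tendsto (fun α => (1 - ε^2) * D.K * c / (α * GG D α)) atTop (nhds 0) :=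
    fun c => Tendsto.div_atTop tendsto_const_nhds (aG_tendsto D)
  filter_upwards [eventually_gt_atTop 0, (hlim 4).eventually_lt_const hη0,
    (hlim (C / δ)).eventually_lt_const hη0] with α hα e1 e2
  have hG := GG_pos D α
  set lam := (1 - ε) * D.K / GG D α with hlam
  have hlam0 : 0 < lam := by
    have : 0 < 1 - ε := by linarith
    positivity
  set lam' := (1 + ε) * lam with hlam'
  have hlam0' : 0 < lam' := by positivity
  set Q := QQ D α (fun _ => 1) with hQ
  have hQc : Continuous Q := Q1_cont D α
  set W : ℝ → ℝ := fun r => lam' * ∫ s in r..1, Q s with hWdef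
  have hWd : ∀ r, HasDerivAt W (-(lam' * Q r)) r := by
    intro r
    have := (intervalIntegral.integral_hasDerivAt_left (hQc.intervalIntegrable r 1)
      (hQc.stronglyMeasurableAtFilter _ _) hQc.continuousAt).const_mul lam'
    exact this.congr_deriv (by ring)
  have hWc : Continuous W := continuous_iff_continuousAt.2 fun x => (hWd x).continuousAt
  have hW0 : W 0 = (1 - ε ^ 2) * D.K := by
    have : W 0 = lam' * GG D α := rfl
    rw [this, hlam', hlam]
    field_simp
    ring
  have hW1 : W 1 = 0 := by simp [hWdef]
  have hWanti : AntitoneOn W (Icc 0 1) := by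
    apply antitoneOn_of_deriv_nonpos (convex_Icc 0 1) hWc.continuousOn
    · exact fun x _ => (hWd x).differentiableAt.differentiableWithinAt
    · intro x hx
      rw [interior_Icc] at hx
      rw [(hWd x).deriv]
      have := Q1_nonneg D α hx.1.le
      have := mul_nonneg hlam0'.le this
      linarith
  set v : ℝ → ℝ := fun r => g (W r) with hv
  have hvd : ∀ r, HasDerivAt v (fh D A (v r) * (-(lam' * Q r))) r :=
    fun r => (hgd (W r)).comp r (hWd r)
  have hvc : Continuous v := continuous_iff_continuousAt.2 fun x => (hvd x).continuousAt
  have hg0 : g 0 = 0 := by have := hgF 0; rwa [FF_zero] at this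
  have hvfc : Continuous (fun t => fh D A (v t)) := (fh_cont D hA).comp hvc
  apply exists_sol D hA hα.le hlam0 hvc
  · intro r hr
    rw [← hg0]
    apply hgm.monotone
    rw [← hW1]
    exact hWanti hr (by simp) hr.2
  · intro r hr
    rw [← hgF A]
    apply hgm.monotone
    refine le_trans ?_ hAK
    rw [← hW0]
    exact hWanti (by simp) hr hr.1
  · intro r hr
    have hkey : ∀ x ∈ Icc (0:ℝ) 1, lam * QQ D α (fun t => fh D A (v t)) x ≤
        fh D A (v x) * (lam' * Q x) := by
      intro x hx
      rcases hx.1.eq_or_lt with h | hx0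
      · rw [← h, hQ, QQ_zero, QQ_zero]; simp
      set c := fh D A (v x) - L * W x with hc
      have h1 : PP D α (fun t => fh D A (v t)) x ≤ PP D α (fun t => c + L * W t) x := by
        apply PP_mono D α hvfc (continuous_const.add (continuous_const.mul hWc)) hx.1
        intro t ht
        have htI : t ∈ Icc (0:ℝ) 1 := ⟨ht.1, ht.2.trans hx.2⟩
        have hWt := hWanti htI hx ht.2
        have a1 := fh_lip D hA (hgm.monotone hWt)
        have a2 := mul_le_mul_of_nonneg_left (hgLip _ _ hWt) hS0
        have a3 : fh D A (v t) - fh D A (v x) ≤ S * (D.f A * (W t - W x)) := a1.trans a2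
        have a4 : S * (D.f A * (W t - W x)) ≤ L * (W t - W x) := by
          rw [hL]; nlinarith
        change fh D A (v t) ≤ c + L * W t
        rw [hc]
        linarith
      have h2 : PP D α (fun t => c + L * W t) x = c * PP D α (fun _ => 1) x + L * PP D α W x := by
        unfold PP
        rw [← intervalIntegral.integral_const_mul, ← intervalIntegral.integral_const_mul,
          ← intervalIntegral.integral_add]
        · congr 1
          ext t
          ring
        · exact (continuous_const.mul ((aa_cont D α).mul continuous_const)).intervalIntegrable _ _
        · exact (continuous_const.mul ((aa_cont D α).mul hWc)).intervalIntegrable _ _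
      have hle : lam' / α = (1 - ε^2) * D.K / (α * GG D α) := by
        rw [hlam', hlam]; field_simp; ring
      have h3 := E_bound D hα hlam0' hδ hδ1 hpq hC (η := η)
        (by rw [hle]; refine le_trans (le_of_eq ?_) e1.le; ring)
        (by rw [hle]; refine le_trans (le_of_eq ?_) e2.le; ring) hWd hx
      have h4 := mul_le_mul_of_nonneg_left h3 hL0.le
      have h5 : L * (2 * η * PP D α (fun _ => 1) x) = ε * D.f 0 * PP D α (fun _ => 1) x := by
        rw [hη]; field_simp
      have hP := PP1_pos D (α := α) hx0
      have h6 : ε * D.f 0 * PP D α (fun _ => 1) x ≤ ε * fh D A (v x) * PP D α (fun _ => 1) x := by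
        have := fh_ge D hA (v x)
        gcongr
      have h7 : PP D α (fun t => fh D A (v t)) x ≤
          (1 + ε) * fh D A (v x) * PP D α (fun _ => 1) x := by
        rw [h2, hc] at h1
        linarith
      have hm := mw_pos D α x
      rw [hQ, QQ_eq_div _ _ _ hx0.ne', QQ_eq_div _ _ _ hx0.ne', hlam']
      calc _ ≤ lam * ((1 + ε) * fh D A (v x) * PP D α (fun _ => 1) x / (x * mw D α x)) := by
            gcongr
        _ = _ := by ring
    unfold TT
    rw [clampI_eq hr, ← intervalIntegral.integral_const_mul]
    have hcc : Continuous (fun x => fh D A (v x) * (lam' * Q x)) :=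
      hvfc.mul (continuous_const.mul hQc)
    calc _ ≤ ∫ x in r..1, fh D A (v x) * (lam' * Q x) := by
          apply intervalIntegral.integral_mono_on hr.2
          · exact (continuous_const.mul (QQ_cont D α hvfc)).intervalIntegrable _ _
          · exact hcc.intervalIntegrable _ _
          · intro x hx
            exact hkey x ⟨hr.1.trans hx.1, hx.2⟩
      _ = -v 1 - -v r := by
          apply intervalIntegral.integral_eq_sub_of_hasDerivAt (f := fun x => -v x)
          · intro x _
            exact (hvd x).neg.congr_deriv (by ring)
          · exact hcc.intervalIntegrable _ _
      _ = v r := by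
          have : v 1 = 0 := by simp only [hv, hW1, hg0]
          rw [this]; ring

lemma lamStar_G (D : GelfandData) :
    Tendsto (fun α => lamStar D α * GG D α / D.K) atTop (nhds 1) := by
  have hK := K_pos D
  have hb : ∀ α, ∀ l ∈ solvableSet D α, l ≤ D.K / GG D α := fun α l hl => by
    rw [le_div_iff₀ (GG_pos D α)]; exact solv_le D hl
  have hlow : ∀ ε, 0 < ε → ε < 1 → ∀ᶠ α in atTop, 1 - ε ≤ lamStar D α * GG D α / D.K := by
    intro ε h0 h1
    filter_upwards [solv_ge D h0 h1] with α hα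
    have h2 : (1 - ε) * D.K / GG D α ≤ lamStar D α := le_csSup ⟨_, hb α⟩ hα
    rw [div_le_iff₀ (GG_pos D α)] at h2
    rw [le_div_iff₀ hK]
    exact h2
  have hup : ∀ᶠ α in atTop, lamStar D α * GG D α / D.K ≤ 1 := by
    filter_upwards [solv_ge D (ε := 1/2) (by norm_num) (by norm_num)] with α hα
    have h2 : lamStar D α ≤ D.K / GG D α := csSup_le ⟨_, hα⟩ (hb α)
    rw [le_div_iff₀ (GG_pos D α)] at h2
    rw [div_le_one hK]
    exact h2
  rw [tendsto_order]
  constructor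
  · intro a ha
    have hm : 0 < min ((1 - a) / 2) (1/2) := lt_min (by linarith) (by norm_num)
    filter_upwards [hlow (min ((1 - a) / 2) (1/2)) hm
      (by linarith [min_le_right ((1 - a) / 2) (1/2)])] with α hα
    linarith [min_le_left ((1 - a) / 2) (1/2)]
  · intro a ha
    filter_upwards [hup] with α hα
    linarith

/-- Sharp asymptotics of the extremal Frank-Kamenetskii parameter:
`λ*(α) · (2Kα / log α)⁻¹ → 1` as `α → ∞`. -/
theorem lamStar_asymptotic (D : GelfandData) :
    Tendsto (fun α : ℝ => lamStar D α * (2 * D.K * α / Real.log α)⁻¹)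
      atTop (nhds 1) := by
  have h := (lamStar_G D).div (GG_asymp D) one_ne_zero
  rw [div_one] at h
  refine h.congr' ?_
  filter_upwards [eventually_gt_atTop 0, Real.tendsto_log_atTop.eventually_gt_atTop 0] with α hα hl
  have := GG_pos D α
  have := K_pos D
  simp only [Pi.div_apply]
  field_simp
end

section
/- Suppose that for every sufficiently large α, u_α is a solution of problem (P_{α,λ*(α)}) (i.e. with parameter λ = λ*(α)). Then, as α → ∞, u_α(r) → 0 for every fixed r ∈ (0,1], and u_α(0) → ∞. -/
open Set MeasureTheory Filter

namespace GP
open Topology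

noncomputable def cl (r : ℝ) : ℝ := max 0 (min 1 r)

lemma cl_mem (r : ℝ) : cl r ∈ Icc (0:ℝ) 1 := by
  unfold cl
  exact ⟨le_max_left _ _, max_le zero_le_one (min_le_left _ _)⟩

lemma cl_eq {r : ℝ} (h : r ∈ Icc (0:ℝ) 1) : cl r = r := by
  unfold cl
  rw [min_eq_right h.2, max_eq_right h.1]

lemma cl_cont : Continuous cl := by unfold cl; fun_prop

lemma cl_lip (r r' : ℝ) : |cl r - cl r'| ≤ |r - r'| := by
  unfold cl
  calc |max 0 (min 1 r) - max 0 (min 1 r')| ≤ |min 1 r - min 1 r'| := by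
        have := abs_max_sub_max_le_max (0:ℝ) (min 1 r) 0 (min 1 r')
        simpa using this
    _ ≤ |r - r'| := by
        have := abs_min_sub_min_le_max (1:ℝ) r 1 r'
        simpa using this

variable (D : GelfandData)

noncomputable def ph (r : ℝ) : ℝ := D.phi (cl r)
noncomputable def ps (r : ℝ) : ℝ := D.psi (cl r)
noncomputable def ff (x : ℝ) : ℝ := D.f (max x 0)

lemma ph_cont : Continuous (ph D) := by
  obtain ⟨L, hL⟩ := D.phi_lip
  exact hL.continuousOn.comp_continuous cl_cont cl_mem

lemma ps_cont : Continuous (ps D) := by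
  obtain ⟨L, hL⟩ := D.psi_lip
  exact hL.continuousOn.comp_continuous cl_cont cl_mem

lemma ff_cont : Continuous (ff D) :=
  D.f_smooth.continuousOn.comp_continuous (by fun_prop) (fun x => le_max_right x 0)

lemma ff_pos (x : ℝ) : 0 < ff D x := D.f_pos _ (le_max_right x 0)

lemma ff_mono : Monotone (ff D) := fun x y h =>
  D.f_mono (le_max_right x 0) (le_max_right y 0) (max_le_max_right 0 h)

lemma ff_eq {x : ℝ} (h : 0 ≤ x) : ff D x = D.f x := by unfold ff; rw [max_eq_left h]

lemma ph_nonneg (r : ℝ) : 0 ≤ ph D r := D.phi_nonneg _ (cl_mem r)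
lemma ps_nonneg (r : ℝ) : 0 ≤ ps D r := D.psi_nonneg _ (cl_mem r)
lemma ph_le (r : ℝ) : ph D r ≤ 1 := by
  have := D.phi_anti (left_mem_Icc.2 zero_le_one) (cl_mem r) (cl_mem r).1
  rwa [D.phi_zero] at this
lemma ps_le (r : ℝ) : ps D r ≤ 1 := by
  have := D.psi_anti (left_mem_Icc.2 zero_le_one) (cl_mem r) (cl_mem r).1
  rwa [D.psi_zero] at this
lemma ps_zero : ps D 0 = 1 := by
  unfold ps; rw [cl_eq (left_mem_Icc.2 zero_le_one), D.psi_zero]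
lemma ph_pos {r : ℝ} (h : r ∈ Ico (0:ℝ) 1) : 0 < ph D r := by
  unfold ph; rw [cl_eq ⟨h.1, h.2.le⟩]; exact D.phi_pos r h

lemma exists_delta : ∃ δ, 0 < δ ∧ δ < 1 ∧ ∀ r ∈ Icc 0 δ, 1/2 ≤ ps D r := by
  have h : ∀ᶠ r in 𝓝 (0:ℝ), 1/2 < ps D r := by
    apply (ps_cont D).continuousAt.eventually_const_lt
    rw [ps_zero]; norm_num
  obtain ⟨e, he, h⟩ := Metric.eventually_nhds_iff.1 h
  refine ⟨min (e/2) (1/2), by positivity, by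
    have := min_le_right (e/2) (1/2:ℝ); linarith, fun r hr => (h ?_).le⟩
  have := hr.2.trans (min_le_left _ _)
  rw [Real.dist_eq, sub_zero, abs_of_nonneg hr.1]; linarith

/-- weight -/
noncomputable def mu (α r : ℝ) : ℝ := Real.exp (α * ∫ s in (0:ℝ)..r, s * ph D s)

lemma mu_pos (α r : ℝ) : 0 < mu D α r := Real.exp_pos _

lemma mu_zero (α : ℝ) : mu D α 0 = 1 := by simp [mu]

lemma mu_deriv (α r : ℝ) : HasDerivAt (mu D α) (α * r * ph D r * mu D α r) r := by
  have hc : Continuous fun s => s * ph D s := continuous_id.mul (ph_cont D)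
  have h := intervalIntegral.integral_hasDerivAt_right (hc.intervalIntegrable 0 r)
    hc.stronglyMeasurable.stronglyMeasurableAtFilter hc.continuousAt
  have := (h.const_mul α).exp
  unfold mu
  convert this using 1
  ring

lemma mu_cont (α : ℝ) : Continuous (mu D α) :=
  continuous_iff_continuousAt.2 fun r => (mu_deriv D α r).continuousAt

lemma mu_mono {α : ℝ} (hα : 0 ≤ α) : MonotoneOn (mu D α) (Ici 0) := by
  apply monotoneOn_of_deriv_nonneg (convex_Ici 0) (mu_cont D α).continuousOn
  · exact fun x _ => (mu_deriv D α x).differentiableAt.differentiableWithinAt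
  · intro x hx
    rw [interior_Ici] at hx
    rw [(mu_deriv D α x).deriv]
    have := ph_nonneg D x
    have := (mu_pos D α x).le
    have : (0:ℝ) ≤ x := le_of_lt hx
    positivity

noncomputable def Pn (α : ℝ) (g : ℝ → ℝ) (s : ℝ) : ℝ := ∫ t in (0:ℝ)..s, g t * (t * mu D α t)

lemma integrand_cont (α : ℝ) {g : ℝ → ℝ} (hg : Continuous g) :
    Continuous fun t => g t * (t * mu D α t) :=
  hg.mul (continuous_id.mul (mu_cont D α))

lemma Pn_deriv (α : ℝ) {g : ℝ → ℝ} (hg : Continuous g) (s : ℝ) :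
    HasDerivAt (Pn D α g) (g s * (s * mu D α s)) s := by
  have hc := integrand_cont D α hg
  exact intervalIntegral.integral_hasDerivAt_right (hc.intervalIntegrable 0 s)
    hc.stronglyMeasurable.stronglyMeasurableAtFilter hc.continuousAt

lemma Pn_cont (α : ℝ) {g : ℝ → ℝ} (hg : Continuous g) : Continuous (Pn D α g) :=
  continuous_iff_continuousAt.2 fun r => (Pn_deriv D α hg r).continuousAt

lemma Pn_zero (α : ℝ) (g : ℝ → ℝ) : Pn D α g 0 = 0 := by simp [Pn]

lemma Pn_mono {α : ℝ} {g1 g2 : ℝ → ℝ} (h1 : Continuous g1) (h2 : Continuous g2)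
    {s : ℝ} (hs : 0 ≤ s) (h : ∀ t ∈ Icc 0 s, g1 t ≤ g2 t) : Pn D α g1 s ≤ Pn D α g2 s := by
  apply intervalIntegral.integral_mono_on hs
    ((integrand_cont D α h1).intervalIntegrable _ _) ((integrand_cont D α h2).intervalIntegrable _ _)
  intro t ht
  exact mul_le_mul_of_nonneg_right (h t ht) (mul_nonneg ht.1 (mu_pos D α t).le)

lemma Pn_const_mul (α c : ℝ) (g : ℝ → ℝ) (s : ℝ) :
    Pn D α (fun t => c * g t) s = c * Pn D α g s := by
  unfold Pn
  rw [← intervalIntegral.integral_const_mul]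
  congr 1; ext t; ring

lemma Pn_nonneg {α : ℝ} {g : ℝ → ℝ} (_h1 : Continuous g)
    {s : ℝ} (hs : 0 ≤ s) (h : ∀ t ∈ Icc 0 s, 0 ≤ g t) : 0 ≤ Pn D α g s := by
  apply intervalIntegral.integral_nonneg hs
  intro t ht
  exact mul_nonneg (h t ht) (mul_nonneg ht.1 (mu_pos D α t).le)

lemma Pn_le {α : ℝ} (hα : 0 ≤ α) {g : ℝ → ℝ} (h1 : Continuous g) {C : ℝ} (hC : 0 ≤ C)
    {s : ℝ} (hs : 0 ≤ s) (h : ∀ t ∈ Icc 0 s, g t ≤ C) :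
    Pn D α g s ≤ C * s * (s * mu D α s) := by
  have : Pn D α g s ≤ ∫ t in (0:ℝ)..s, C * (s * mu D α s) := by
    apply intervalIntegral.integral_mono_on hs
      ((integrand_cont D α h1).intervalIntegrable _ _) (by simp)
    intro t ht
    have hm := mu_mono D hα (show t ∈ Ici 0 from ht.1) (show s ∈ Ici 0 from hs) ht.2
    have := (mu_pos D α t).le
    calc g t * (t * mu D α t) ≤ C * (t * mu D α t) :=
          mul_le_mul_of_nonneg_right (h t ht) (mul_nonneg ht.1 this)
      _ ≤ _ := mul_le_mul_of_nonneg_left (mul_le_mul ht.2 hm this hs) hC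
  simp at this
  linarith

noncomputable def Q (α : ℝ) (g : ℝ → ℝ) (r : ℝ) : ℝ :=
  Pn D α g (cl r) / (cl r * mu D α (cl r))

lemma Q_nonneg {α : ℝ} {g : ℝ → ℝ} (h1 : Continuous g)
    (h : ∀ t ∈ Icc (0:ℝ) 1, 0 ≤ g t) (r : ℝ) : 0 ≤ Q D α g r :=
  div_nonneg (Pn_nonneg D h1 (cl_mem r).1 fun t ht => h t ⟨ht.1, ht.2.trans (cl_mem r).2⟩)
    (mul_nonneg (cl_mem r).1 (mu_pos D α _).le)

lemma Q_le {α : ℝ} (hα : 0 ≤ α) {g : ℝ → ℝ} (h1 : Continuous g) {C : ℝ} (hC : 0 ≤ C)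
    (h : ∀ t ∈ Icc (0:ℝ) 1, g t ≤ C) (r : ℝ) : Q D α g r ≤ C * cl r := by
  have h2 := Pn_le D hα h1 hC (cl_mem r).1 fun t ht => h t ⟨ht.1, ht.2.trans (cl_mem r).2⟩
  unfold Q
  rcases eq_or_lt_of_le (cl_mem r).1 with h0 | h0
  · rw [← h0]; simp
  · rwa [div_le_iff₀ (mul_pos h0 (mu_pos D α _))]

lemma Q_mono {α : ℝ} {g1 g2 : ℝ → ℝ} (h1 : Continuous g1) (h2 : Continuous g2)
    (h : ∀ t ∈ Icc (0:ℝ) 1, g1 t ≤ g2 t) (r : ℝ) : Q D α g1 r ≤ Q D α g2 r :=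
  div_le_div_of_nonneg_right
    (Pn_mono D h1 h2 (cl_mem r).1 fun t ht => h t ⟨ht.1, ht.2.trans (cl_mem r).2⟩)
    (mul_nonneg (cl_mem r).1 (mu_pos D α _).le)

lemma Q_cont {α : ℝ} (hα : 0 ≤ α) {g : ℝ → ℝ} (h1 : Continuous g)
    (h : ∀ t ∈ Icc (0:ℝ) 1, 0 ≤ g t) : Continuous (Q D α g) := by
  obtain ⟨C, hC⟩ := (isCompact_Icc (a := (0:ℝ)) (b := 1)).exists_bound_of_continuousOn
    h1.continuousOn
  have hC' : ∀ t ∈ Icc (0:ℝ) 1, g t ≤ C := fun t ht => (le_abs_self _).trans (hC t ht)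
  have hC0 : 0 ≤ C := (h 0 (by simp)).trans (hC' 0 (by simp))
  rw [continuous_iff_continuousAt]
  intro r
  by_cases h0 : cl r = 0
  · have hz : Q D α g r = 0 := by simp [Q, h0]
    unfold ContinuousAt
    rw [hz]
    apply squeeze_zero (Q_nonneg D h1 h) (Q_le D hα h1 hC0 hC')
    have : Tendsto (fun t => C * cl t) (𝓝 r) (𝓝 (C * cl r)) :=
      (continuous_const.mul cl_cont).continuousAt
    simpa [h0] using this
  · unfold Q
    apply ContinuousAt.div
    · exact ((Pn_cont D α h1).comp cl_cont).continuousAt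
    · exact (cl_cont.mul ((mu_cont D α).comp cl_cont)).continuousAt
    · exact mul_ne_zero h0 (mu_pos D α _).ne'

lemma Q_deriv {α : ℝ} {g : ℝ → ℝ} (h1 : Continuous g) {r : ℝ} (hr : r ∈ Ioo (0:ℝ) 1) :
    HasDerivAt (Q D α g) (g r - (1 / r + α * r * ph D r) * Q D α g r) r := by
  have hr0 : r ≠ 0 := hr.1.ne'
  have hm : mu D α r ≠ 0 := (mu_pos D α r).ne'
  have h := (Pn_deriv D α h1 r).div ((hasDerivAt_id r).mul (mu_deriv D α r))
    (mul_ne_zero hr0 hm)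
  have he : Q D α g =ᶠ[𝓝 r] (Pn D α g / (id * mu D α)) := by
    filter_upwards [Ioo_mem_nhds hr.1 hr.2] with x hx
    simp [Q, cl_eq (Ioo_subset_Icc_self hx)]
  have h' := h.congr_of_eventuallyEq he
  refine h'.congr_deriv ?_
  rw [he.eq_of_nhds]
  simp
  field_simp

noncomputable def W (α : ℝ) (g : ℝ → ℝ) (r : ℝ) : ℝ := ∫ s in r..1, Q D α g s

lemma W_deriv {α : ℝ} (hα : 0 ≤ α) {g : ℝ → ℝ} (h1 : Continuous g)
    (h : ∀ t ∈ Icc (0:ℝ) 1, 0 ≤ g t) (r : ℝ) : HasDerivAt (W D α g) (- Q D α g r) r := by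
  have hc := Q_cont D hα h1 h
  exact intervalIntegral.integral_hasDerivAt_left (hc.intervalIntegrable r 1)
    hc.stronglyMeasurable.stronglyMeasurableAtFilter hc.continuousAt

lemma W_cont {α : ℝ} (hα : 0 ≤ α) {g : ℝ → ℝ} (h1 : Continuous g)
    (h : ∀ t ∈ Icc (0:ℝ) 1, 0 ≤ g t) : Continuous (W D α g) :=
  continuous_iff_continuousAt.2 fun r => (W_deriv D hα h1 h r).continuousAt

lemma W_one (α : ℝ) (g : ℝ → ℝ) : W D α g 1 = 0 := by simp [W]

lemma W_mono {α : ℝ} (hα : 0 ≤ α) {g1 g2 : ℝ → ℝ} (h1 : Continuous g1) (h2 : Continuous g2)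
    (h0 : ∀ t ∈ Icc (0:ℝ) 1, 0 ≤ g1 t)
    (h : ∀ t ∈ Icc (0:ℝ) 1, g1 t ≤ g2 t) {r : ℝ} (hr : r ≤ 1) : W D α g1 r ≤ W D α g2 r :=
  intervalIntegral.integral_mono_on hr ((Q_cont D hα h1 h0).intervalIntegrable _ _)
    ((Q_cont D hα h2 fun t ht => (h0 t ht).trans (h t ht)).intervalIntegrable _ _)
    fun t _ => Q_mono D h1 h2 h t

lemma W_nonneg {α : ℝ} {g : ℝ → ℝ} (h1 : Continuous g)
    (h : ∀ t ∈ Icc (0:ℝ) 1, 0 ≤ g t) {r : ℝ} (hr : r ≤ 1) : 0 ≤ W D α g r :=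
  intervalIntegral.integral_nonneg hr fun t _ => Q_nonneg D h1 h t

lemma W_anti {α : ℝ} (hα : 0 ≤ α) {g : ℝ → ℝ} (h1 : Continuous g)
    (h : ∀ t ∈ Icc (0:ℝ) 1, 0 ≤ g t) : Antitone (W D α g) := by
  apply antitone_of_deriv_nonpos
  · exact fun r => (W_deriv D hα h1 h r).differentiableAt
  · intro r
    rw [(W_deriv D hα h1 h r).deriv]
    have := Q_nonneg (α := α) D h1 h r
    linarith

lemma Q_pos {α : ℝ} {g : ℝ → ℝ} (h1 : Continuous g)
    (h : ∀ t ∈ Icc (0:ℝ) 1, 0 ≤ g t) (h0 : 0 < g 0) {r : ℝ} (hr : r ∈ Ioc (0:ℝ) 1) :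
    0 < Q D α g r := by
  unfold Q
  rw [cl_eq (Ioc_subset_Icc_self hr)]
  apply div_pos _ (mul_pos hr.1 (mu_pos D α r))
  apply intervalIntegral.integral_pos hr.1 (integrand_cont D α h1).continuousOn
  · intro t ht
    exact mul_nonneg (h t ⟨ht.1.le, ht.2.trans hr.2⟩) (mul_nonneg ht.1.le (mu_pos D α t).le)
  · have he : ∀ᶠ t in 𝓝[>] (0:ℝ), 0 < g t :=
      (h1.continuousAt.eventually_const_lt h0).filter_mono nhdsWithin_le_nhds
    obtain ⟨t, ht, ht2⟩ := (he.and (Ioo_mem_nhdsGT hr.1)).exists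
    exact ⟨t, Ioo_subset_Icc_self ht2, mul_pos ht (mul_pos ht2.1 (mu_pos D α t))⟩

lemma W_pos {α : ℝ} (hα : 0 ≤ α) {g : ℝ → ℝ} (h1 : Continuous g)
    (h : ∀ t ∈ Icc (0:ℝ) 1, 0 ≤ g t) (h0 : 0 < g 0) {r : ℝ} (hr : r ∈ Ico (0:ℝ) 1) :
    0 < W D α g r := by
  apply intervalIntegral.integral_pos hr.2 (Q_cont D hα h1 h).continuousOn
  · exact fun t _ => Q_nonneg D h1 h t
  · exact ⟨1, ⟨hr.2.le, le_rfl⟩, Q_pos D h1 h h0 ⟨zero_lt_one, le_rfl⟩⟩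

noncomputable def G (x : ℝ) : ℝ := ∫ s in (0:ℝ)..x, 1 / ff D s

lemma inv_cont : Continuous fun s => 1 / ff D s :=
  continuous_const.div (ff_cont D) fun x => (ff_pos D x).ne'

lemma G_deriv (x : ℝ) : HasDerivAt (G D) (1 / ff D x) x := by
  have hc := inv_cont D
  exact intervalIntegral.integral_hasDerivAt_right (hc.intervalIntegrable 0 x)
    hc.stronglyMeasurable.stronglyMeasurableAtFilter hc.continuousAt

lemma G_cont : Continuous (G D) :=
  continuous_iff_continuousAt.2 fun r => (G_deriv D r).continuousAt

lemma G_strict : StrictMono (G D) := by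
  apply strictMono_of_deriv_pos
  intro x
  rw [(G_deriv D x).deriv]
  exact one_div_pos.2 (ff_pos D x)

lemma G_zero : G D 0 = 0 := by simp [G]

lemma G_tendsto : Tendsto (G D) atTop (𝓝 D.K) := by
  have h : IntegrableOn (fun s => 1 / ff D s) (Ioi 0) := by
    refine D.f_int.congr_fun (fun s hs => ?_) measurableSet_Ioi
    simp only [ff_eq D (le_of_lt hs)]
  have := intervalIntegral_tendsto_integral_Ioi 0 h tendsto_id
  rw [D.K_def]
  have he : (∫ s in Ioi (0:ℝ), 1 / D.f s) = ∫ s in Ioi (0:ℝ), 1 / ff D s :=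
    setIntegral_congr_fun measurableSet_Ioi fun s hs => by simp only [ff_eq D (le_of_lt hs)]
  rw [he]
  exact this

lemma G_lt (x : ℝ) : G D x < D.K :=
  (G_strict D (lt_add_one x)).trans_le ((G_strict D).monotone.ge_of_tendsto (G_tendsto D) _)

lemma K_pos : 0 < D.K := by
  have := G_lt D 0
  rwa [G_zero] at this

noncomputable def Gi : ℝ → ℝ := Function.invFun (G D)

lemma Gi_G (x : ℝ) : Gi D (G D x) = x := Function.leftInverse_invFun (G_strict D).injective x

lemma exists_G {y : ℝ} (hy : y ∈ Ico 0 D.K) : ∃ x, 0 ≤ x ∧ G D x = y := by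
  obtain ⟨b, hb⟩ := ((G_tendsto D).eventually_const_lt hy.2).exists
  obtain ⟨x, hx⟩ := mem_range_of_exists_le_of_exists_ge (G_cont D)
    ⟨0, (G_zero D).trans_le hy.1⟩ ⟨b, hb.le⟩
  refine ⟨x, ?_, hx⟩
  rw [← (G_strict D).le_iff_le, G_zero, hx]; exact hy.1

lemma G_Gi {y : ℝ} (hy : y ∈ Ico 0 D.K) : G D (Gi D y) = y := by
  obtain ⟨x, _, rfl⟩ := exists_G D hy
  rw [Gi_G]

lemma Gi_nonneg {y : ℝ} (hy : y ∈ Ico 0 D.K) : 0 ≤ Gi D y := by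
  rw [← (G_strict D).le_iff_le, G_zero, G_Gi D hy]; exact hy.1

lemma Gi_mono {y z : ℝ} (hy : y ∈ Ico 0 D.K) (hz : z ∈ Ico 0 D.K) (h : y ≤ z) :
    Gi D y ≤ Gi D z := by
  rw [← (G_strict D).le_iff_le, G_Gi D hy, G_Gi D hz]; exact h

lemma Gi_deriv {y : ℝ} (hy : y ∈ Ico 0 D.K) : HasDerivAt (Gi D) (ff D (Gi D y)) y := by
  obtain ⟨x, hx, rfl⟩ := exists_G D hy
  rw [Gi_G]
  have hev : ∀ᶠ z in 𝓝 (G D x), G D (Gi D z) = z := by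
    filter_upwards [Ioo_mem_nhds (G_strict D (sub_one_lt x)) (G_strict D (lt_add_one x))]
      with z hz
    obtain ⟨t, rfl⟩ := mem_range_of_exists_le_of_exists_ge (G_cont D)
      ⟨_, hz.1.le⟩ ⟨_, hz.2.le⟩
    rw [Gi_G]
  have hemb : Topology.IsEmbedding (G D) :=
    (G_strict D).isEmbedding_of_ordConnected (isPreconnected_range (G_cont D)).ordConnected
  have hc : ContinuousAt (Gi D) (G D x) := by
    unfold ContinuousAt
    rw [hemb.tendsto_nhds_iff, Gi_G]
    exact tendsto_id.congr' (hev.mono fun z hz => hz.symm)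
  have h := HasDerivAt.of_local_left_inverse hc
    (by rw [Gi_G]; exact G_deriv D x) (one_div_pos.2 (ff_pos D x)).ne' hev
  simpa using h

/-- existence from a supersolution -/
noncomputable def T (α lam : ℝ) (v : ℝ → ℝ) (r : ℝ) : ℝ :=
  W D α (fun s => lam * (ps D s * ff D (v s))) (cl r)

lemma src_cont (lam : ℝ) {v : ℝ → ℝ} (hv : Continuous v) :
    Continuous (fun s => lam * (ps D s * ff D (v s))) :=
  continuous_const.mul ((ps_cont D).mul ((ff_cont D).comp hv))

lemma src_nonneg {lam : ℝ} (hl : 0 ≤ lam) (v : ℝ → ℝ) (s : ℝ) :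
    0 ≤ lam * (ps D s * ff D (v s)) :=
  mul_nonneg hl (mul_nonneg (ps_nonneg D s) (ff_pos D _).le)

lemma T_cont {α lam : ℝ} (hα : 0 ≤ α) (hl : 0 ≤ lam) {v : ℝ → ℝ} (hv : Continuous v) :
    Continuous (T D α lam v) :=
  (W_cont D hα (src_cont D lam hv) fun t _ => src_nonneg D hl v t).comp cl_cont

lemma T_mono {α lam : ℝ} (hα : 0 ≤ α) (hl : 0 ≤ lam) {v v' : ℝ → ℝ} (hv : Continuous v)
    (hv' : Continuous v') (h : ∀ r, v r ≤ v' r) (r : ℝ) : T D α lam v r ≤ T D α lam v' r := by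
  apply W_mono D hα (src_cont D lam hv) (src_cont D lam hv')
    (fun t _ => src_nonneg D hl v t) _ (cl_mem r).2
  intro t _
  exact mul_le_mul_of_nonneg_left
    (mul_le_mul_of_nonneg_left (ff_mono D (h t)) (ps_nonneg D t)) hl

lemma T_lip {α lam : ℝ} (hα : 0 ≤ α) (hl : 0 ≤ lam) {v : ℝ → ℝ} (hv : Continuous v) {B : ℝ}
    (h : ∀ r, v r ≤ B) (r r' : ℝ) :
    |T D α lam v r - T D α lam v r'| ≤ lam * ff D B * |r - r'| := by
  have hs := src_cont D lam hv
  have hn := src_nonneg D hl v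
  have hq := Q_cont D hα hs fun t _ => hn t
  have hB : 0 ≤ lam * ff D B := mul_nonneg hl (ff_pos D B).le
  have h1 : ∀ x ∈ (univ : Set ℝ), ‖deriv (W D α fun s => lam * (ps D s * ff D (v s))) x‖
      ≤ lam * ff D B := by
    intro x _
    rw [(W_deriv D hα hs (fun t _ => hn t) x).deriv, norm_neg, Real.norm_eq_abs,
      abs_of_nonneg (Q_nonneg D hs (fun t _ => hn t) x)]
    refine (Q_le D hα hs hB (fun t _ => ?_) x).trans (mul_le_of_le_one_right hB (cl_mem x).2)
    apply mul_le_mul_of_nonneg_left _ hl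
    calc ps D t * ff D (v t) ≤ 1 * ff D (v t) :=
          mul_le_mul_of_nonneg_right (ps_le D t) (ff_pos D _).le
      _ ≤ ff D B := by rw [one_mul]; exact ff_mono D (h t)
  have h2 := Convex.norm_image_sub_le_of_norm_deriv_le
    (fun x _ => (W_deriv D hα hs (fun t _ => hn t) x).differentiableAt) h1 convex_univ
    (mem_univ (cl r')) (mem_univ (cl r))
  exact h2.trans (mul_le_mul_of_nonneg_left (cl_lip r r') hB)

theorem exists_fix {α lam : ℝ} (hα : 0 ≤ α) (hl : 0 ≤ lam) {U : ℝ → ℝ} (hUc : Continuous U)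
    (hU0 : ∀ r, 0 ≤ U r) {B : ℝ} (hUB : ∀ r, U r ≤ B) (hU : ∀ r, T D α lam U r ≤ U r) :
    ∃ v : ℝ → ℝ, Continuous v ∧ ∀ r, v r = T D α lam v r := by
  let it : ℕ → ℝ → ℝ := fun n => (T D α lam)^[n] (fun _ => 0)
  have hit : ∀ n, it (n+1) = T D α lam (it n) := fun n =>
    Function.iterate_succ_apply' _ _ _
  have hc : ∀ n, Continuous (it n) := by
    intro n
    induction n with
    | zero => exact continuous_const
    | succ n ih => rw [hit]; exact T_cont D hα hl ih
  have hle : ∀ n r, it n r ≤ U r := by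
    intro n
    induction n with
    | zero => exact hU0
    | succ n ih =>
      intro r; rw [hit]; exact (T_mono D hα hl (hc n) hUc ih r).trans (hU r)
  have hmono : ∀ n r, it n r ≤ it (n+1) r := by
    intro n
    induction n with
    | zero =>
      intro r
      rw [hit]
      exact W_nonneg D (src_cont D lam (hc 0)) (fun t _ => src_nonneg D hl _ t) (cl_mem r).2
    | succ n ih =>
      intro r; rw [hit (n+1)]; nth_rewrite 1 [hit n]; exact T_mono D hα hl (hc n) (hc (n+1)) ih r
  have hlim : ∀ r, ∃ l, Tendsto (fun n => it n r) atTop (𝓝 l) := fun r =>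
    ⟨_, tendsto_atTop_ciSup (monotone_nat_of_le_succ fun n => hmono n r)
      ⟨U r, by rintro _ ⟨n, rfl⟩; exact hle n r⟩⟩
  choose v hv using hlim
  have hitB : ∀ n r, it n r ≤ B := fun n r => (hle n r).trans (hUB r)
  have hvB : ∀ r, v r ≤ B := fun r => le_of_tendsto' (hv r) fun n => hitB n r
  have hff : ∀ x, x ≤ B → ff D x ≤ ff D B := fun x h => ff_mono D h
  have hlip : ∀ r r', |v r - v r'| ≤ lam * ff D B * |r - r'| := by
    intro r r'
    have h1 := (((hv r).sub (hv r')).abs).comp (tendsto_add_atTop_nat 1)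
    refine le_of_tendsto' h1 fun n => ?_
    simp only [Function.comp, hit]
    exact T_lip D hα hl (hc n) (hitB n) r r'
  have hBn : 0 ≤ lam * ff D B := mul_nonneg hl (ff_pos D B).le
  have hvc : Continuous v :=
    (LipschitzWith.of_dist_le_mul (K := ⟨_, hBn⟩) hlip).continuous
  refine ⟨v, hvc, fun r => ?_⟩
  have hsB : ∀ x, x ≤ B → ∀ t, |lam * (ps D t * ff D x)| ≤ lam * ff D B := by
    intro x hx t
    rw [abs_of_nonneg (mul_nonneg hl (mul_nonneg (ps_nonneg D t) (ff_pos D x).le))]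
    apply mul_le_mul_of_nonneg_left _ hl
    calc ps D t * ff D x ≤ 1 * ff D x :=
          mul_le_mul_of_nonneg_right (ps_le D t) (ff_pos D x).le
      _ ≤ ff D B := by rw [one_mul]; exact hff x hx
  have hP : ∀ s, Tendsto (fun n => Pn D α (fun s => lam * (ps D s * ff D (it n s))) s) atTop
      (𝓝 (Pn D α (fun s => lam * (ps D s * ff D (v s))) s)) := by
    intro s
    apply intervalIntegral.tendsto_integral_filter_of_dominated_convergence
      (fun t => lam * ff D B * |t * mu D α t|)
    · exact Eventually.of_forall fun n =>
        (integrand_cont D α (src_cont D lam (hc n))).aestronglyMeasurable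
    · refine Eventually.of_forall fun n => Eventually.of_forall fun t _ => ?_
      rw [Real.norm_eq_abs, abs_mul]
      exact mul_le_mul_of_nonneg_right (hsB _ (hitB n t) t) (abs_nonneg _)
    · apply Continuous.intervalIntegrable
      exact continuous_const.mul (continuous_id.mul (mu_cont D α)).abs
    · refine Eventually.of_forall fun t _ => ?_
      exact ((((ff_cont D).tendsto _).comp (hv t)).const_mul _ |>.const_mul lam).mul_const _
  have hW : Tendsto (fun n => T D α lam (it n) r) atTop (𝓝 (T D α lam v r)) := by
    apply intervalIntegral.tendsto_integral_filter_of_dominated_convergence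
      (fun _ => lam * ff D B)
    · exact Eventually.of_forall fun n =>
        (Q_cont D hα (src_cont D lam (hc n)) fun t _ => src_nonneg D hl _ t).aestronglyMeasurable
    · refine Eventually.of_forall fun n => Eventually.of_forall fun t _ => ?_
      rw [Real.norm_eq_abs, abs_of_nonneg
        (Q_nonneg D (src_cont D lam (hc n)) (fun t _ => src_nonneg D hl _ t) t)]
      have h1 := Q_le D hα (src_cont D lam (hc n)) hBn
        (fun t _ => (le_abs_self _).trans (hsB _ (hitB n t) t)) t
      exact h1.trans (mul_le_of_le_one_right hBn (cl_mem t).2)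
    · simp
    · refine Eventually.of_forall fun t _ => ?_
      exact (hP (cl t)).div_const _
  have h2 := (hv r).comp (tendsto_add_atTop_nat 1)
  refine tendsto_nhds_unique h2 (hW.congr fun n => ?_)
  simp only [Function.comp, hit]

theorem sol_of_fix {α lam : ℝ} (hα : 0 ≤ α) (hl : 0 < lam) {v : ℝ → ℝ} (hvc : Continuous v)
    (hv : ∀ r, v r = T D α lam v r) : IsSolution D α lam v := by
  set g : ℝ → ℝ := fun s => lam * (ps D s * ff D (v s)) with hg
  have hgc : Continuous g := src_cont D lam hvc
  have hg0 : ∀ t ∈ Icc (0:ℝ) 1, 0 ≤ g t := fun t _ => src_nonneg D hl.le v t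
  have hgp : 0 < g 0 := by
    simp only [hg, ps_zero, one_mul]
    exact mul_pos hl (ff_pos D _)
  have hqc := Q_cont D hα hgc hg0
  have hvW : ∀ r ∈ Icc (0:ℝ) 1, v r = W D α g r := by
    intro r hr
    rw [hv r]; unfold T; rw [cl_eq hr]
  have hWd := W_deriv D hα hgc hg0
  have hWderiv : deriv (W D α g) = fun r => - Q D α g r := funext fun r => (hWd r).deriv
  have hder : ∀ r ∈ Icc (0:ℝ) 1, HasDerivWithinAt v (- Q D α g r) (Icc 0 1) r := fun r hr =>
    (hWd r).hasDerivWithinAt.congr hvW (hvW r hr)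
  have hdw : ∀ r ∈ Icc (0:ℝ) 1, derivWithin v (Icc 0 1) r = - Q D α g r := fun r hr =>
    (hder r hr).derivWithin (uniqueDiffOn_Icc zero_lt_one r hr)
  have hW1 : ContDiff ℝ 1 (W D α g) := by
    rw [contDiff_one_iff_deriv]
    refine ⟨fun r => (hWd r).differentiableAt, ?_⟩
    rw [hWderiv]; exact hqc.neg
  have hsub : Ioo (0:ℝ) 1 ⊆ Icc 0 1 := Ioo_subset_Icc_self
  have hQ1 : ContDiffOn ℝ 1 (fun r => - Q D α g r) (Ioo 0 1) := by
    rw [show (1 : WithTop ℕ∞) = 0 + 1 by simp, contDiffOn_succ_iff_deriv_of_isOpen isOpen_Ioo]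
    refine ⟨fun r hr => (Q_deriv D hgc hr).neg.differentiableAt.differentiableWithinAt,
      by simp, ?_⟩
    rw [contDiffOn_zero]
    have : ContinuousOn (fun r => -(g r - (1 / r + α * r * ph D r) * Q D α g r)) (Ioo 0 1) := by
      have h1 : ContinuousOn (fun r : ℝ => 1 / r) (Ioo 0 1) :=
        continuousOn_const.div continuousOn_id fun r hr => hr.1.ne'
      have h2 := ph_cont D
      have h3 := hgc.continuousOn (s := Ioo 0 1)
      have h4 := hqc.continuousOn (s := Ioo 0 1)
      have h5 : Continuous fun r => α * r * ph D r := by fun_prop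
      exact (h3.sub ((h1.add h5.continuousOn).mul h4)).neg
    exact this.congr fun r hr => (Q_deriv D hgc hr).neg.deriv
  refine ⟨hW1.contDiffOn.congr hvW, ?_, ?_, ?_, ?_, ?_⟩
  · have : ContDiffOn ℝ 2 (W D α g) (Ioo 0 1) := by
      rw [show (2 : WithTop ℕ∞) = 1 + 1 by norm_num,
        contDiffOn_succ_iff_deriv_of_isOpen isOpen_Ioo]
      refine ⟨fun r _ => (hWd r).differentiableAt.differentiableWithinAt, by simp, ?_⟩
      rw [hWderiv]; exact hQ1
    exact this.congr fun r hr => hvW r (hsub hr)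
  · intro r hr
    rw [hvW r ⟨hr.1, hr.2.le⟩]
    exact W_pos D hα hgc hg0 hgp hr
  · rw [hdw 0 (by simp)]
    simp [Q, cl]
  · rw [hvW 1 (by simp), W_one]
  · intro r hr
    have h1 : derivWithin (derivWithin v (Icc 0 1)) (Ioo 0 1) r
        = -(g r - (1 / r + α * r * ph D r) * Q D α g r) := by
      rw [derivWithin_congr (f := fun r => - Q D α g r) (fun x hx => hdw x (hsub hx))
        (hdw r (hsub hr))]
      exact (Q_deriv D hgc hr).neg.hasDerivWithinAt.derivWithin
        (isOpen_Ioo.uniqueDiffWithinAt hr)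
    rw [h1, hdw r (hsub hr)]
    have h2 : ph D r = D.phi r := by unfold ph; rw [cl_eq (hsub hr)]
    have h3 : ps D r = D.psi r := by unfold ps; rw [cl_eq (hsub hr)]
    have h4 : 0 ≤ v r := by
      rw [hvW r (hsub hr)]; exact W_nonneg D hgc hg0 hr.2.le
    rw [← h2, ← h3, ← ff_eq D h4]
    simp only [hg]
    ring

lemma ff_diff {x : ℝ} (hx : 0 < x) : HasDerivAt (ff D) (deriv (ff D) x) x := by
  have h1 : DifferentiableAt ℝ D.f x :=
    (D.f_smooth.differentiableOn (by simp)).differentiableAt (Ici_mem_nhds hx)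
  have he : ff D =ᶠ[𝓝 x] D.f := by
    filter_upwards [Ioi_mem_nhds hx] with y hy using ff_eq D (le_of_lt hy)
  exact (h1.congr_of_eventuallyEq he).hasDerivAt

lemma ff_deriv_nonneg (x : ℝ) : 0 ≤ deriv (ff D) x := (ff_mono D).deriv_nonneg

lemma ff_deriv_le {x C : ℝ} (hx : 0 < x) (hC : x ≤ C) : deriv (ff D) x ≤ ff D (C + 1) := by
  have h1 : DifferentiableAt ℝ D.f x :=
    (D.f_smooth.differentiableOn (by simp)).differentiableAt (Ici_mem_nhds hx)
  have he : ff D =ᶠ[𝓝 x] D.f := by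
    filter_upwards [Ioi_mem_nhds hx] with y hy using ff_eq D (le_of_lt hy)
  rw [he.deriv_eq]
  have h2 := D.f_convex.deriv_le_slope (x := x) (y := C + 1) hx.le
    (by simp only [mem_Ici]; linarith) (by linarith) h1
  refine h2.trans ?_
  rw [ff_eq D (by linarith), slope_def_field, div_le_iff₀ (by linarith)]
  have h3 := D.f_pos x hx.le
  have h4 := D.f_pos (C+1) (by linarith)
  nlinarith

lemma ps_nn : ∀ t ∈ Icc (0:ℝ) 1, 0 ≤ ps D t := fun t _ => ps_nonneg D t

theorem sol_bounds {α lam : ℝ} (hα : 0 ≤ α) {u : ℝ → ℝ} (hu : IsSolution D α lam u) :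
    ∀ r ∈ Icc (0:ℝ) 1, 0 ≤ G D (u r) - lam * W D α (ps D) r ∧
      G D (u r) - lam * W D α (ps D) r ≤ G D (u 0) - lam * W D α (ps D) 0 := by
  obtain ⟨h1, h2, hpos, h0, hu1, hode⟩ := hu
  set d := derivWithin u (Icc 0 1) with hd
  have hdc : ContinuousOn d (Icc 0 1) :=
    h1.continuousOn_derivWithin (uniqueDiffOn_Icc zero_lt_one) (by simp)
  have huc : ContinuousOn u (Icc 0 1) := h1.continuousOn
  have hnh : ∀ r ∈ Ioo (0:ℝ) 1, Icc (0:ℝ) 1 ∈ 𝓝 r := fun r hr => Icc_mem_nhds hr.1 hr.2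
  have hud : ∀ r ∈ Ioo (0:ℝ) 1, HasDerivAt u (d r) r := fun r hr =>
    ((h1.differentiableOn (by simp) r (Ioo_subset_Icc_self hr)).hasDerivWithinAt).hasDerivAt
      (hnh r hr)
  have hdd : ∀ r ∈ Ioo (0:ℝ) 1, HasDerivAt d
      (-(lam * ps D r * ff D (u r)) - (1 / r + α * r * ph D r) * d r) r := by
    intro r hr
    have hdiff : DifferentiableOn ℝ d (Ioo 0 1) := by
      rw [show (2 : WithTop ℕ∞) = 1 + 1 by norm_num,
        contDiffOn_succ_iff_deriv_of_isOpen isOpen_Ioo] at h2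
      exact (h2.2.2.differentiableOn (by simp)).congr fun x hx => (hud x hx).deriv.symm
    have h3 := (hdiff r hr).hasDerivWithinAt.hasDerivAt (isOpen_Ioo.mem_nhds hr)
    refine h3.congr_deriv ?_
    have h4 := hode r hr
    have e2 : ph D r = D.phi r := by unfold ph; rw [cl_eq (Ioo_subset_Icc_self hr)]
    have e3 : ps D r = D.psi r := by unfold ps; rw [cl_eq (Ioo_subset_Icc_self hr)]
    rw [e2, e3, ff_eq D (hpos r ⟨hr.1.le, hr.2⟩).le]
    linarith
  have hfu : ContinuousOn (fun r => ff D (u r)) (Icc 0 1) := (ff_cont D).comp_continuousOn huc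
  have hy : ∀ r ∈ Icc (0:ℝ) 1, 0 ≤ -(r * mu D α r * d r / ff D (u r)) - lam * Pn D α (ps D) r := by
    have hm : MonotoneOn (fun r => -(r * mu D α r * d r / ff D (u r)) - lam * Pn D α (ps D) r)
        (Icc 0 1) := by
      have hder : ∀ r ∈ Ioo (0:ℝ) 1, HasDerivAt
          (fun r => -(r * mu D α r * d r / ff D (u r)) - lam * Pn D α (ps D) r)
          (r * mu D α r * (d r) ^ 2 * deriv (ff D) (u r) / ff D (u r) ^ 2) r := by
        intro r hr
        have hr0 : r ≠ 0 := hr.1.ne'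
        have hf0 := (ff_pos D (u r)).ne'
        have e1 := ((ff_diff D (hpos r ⟨hr.1.le, hr.2⟩)).comp r (hud r hr))
        have e2 := ((hasDerivAt_id r).mul (mu_deriv D α r)).mul (hdd r hr)
        have e3 := (e2.div e1 hf0).neg.sub ((Pn_deriv D α (ps_cont D) r).const_mul lam)
        refine (e3.congr_deriv ?_)
        simp
        field_simp
        ring
      apply monotoneOn_of_deriv_nonneg (convex_Icc 0 1)
      · apply ContinuousOn.sub
        · exact (((continuousOn_id.mul (mu_cont D α).continuousOn).mul hdc).div hfu
            fun r _ => (ff_pos D _).ne').neg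
        · exact (continuous_const.mul (Pn_cont D α (ps_cont D))).continuousOn
      · rw [interior_Icc]
        exact fun r hr => (hder r hr).differentiableAt.differentiableWithinAt
      · rw [interior_Icc]
        intro r hr
        rw [(hder r hr).deriv]
        have := (mu_pos D α r).le
        have := ff_deriv_nonneg D (u r)
        have := hr.1.le
        positivity
    intro r hr
    have := hm (left_mem_Icc.2 zero_le_one) hr hr.1
    simpa [Pn_zero] using this
  have hz : AntitoneOn (fun r => G D (u r) - lam * W D α (ps D) r) (Icc 0 1) := by
    have hder : ∀ r ∈ Ioo (0:ℝ) 1, HasDerivAt (fun r => G D (u r) - lam * W D α (ps D) r)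
        (1 / ff D (u r) * d r - lam * (- Q D α (ps D) r)) r := fun r hr =>
      ((G_deriv D (u r)).comp r (hud r hr)).sub
        ((W_deriv D hα (ps_cont D) (ps_nn D) r).const_mul lam)
    apply antitoneOn_of_deriv_nonpos (convex_Icc 0 1)
    · exact ((G_cont D).comp_continuousOn huc).sub
        (continuous_const.mul (W_cont D hα (ps_cont D) (ps_nn D))).continuousOn
    · rw [interior_Icc]
      exact fun r hr => (hder r hr).differentiableAt.differentiableWithinAt
    · rw [interior_Icc]
      intro r hr
      rw [(hder r hr).deriv]
      have h5 := hy r (Ioo_subset_Icc_self hr)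
      have h6 : 0 < r * mu D α r := mul_pos hr.1 (mu_pos D α r)
      have h7 : 1 / ff D (u r) * d r - lam * (- Q D α (ps D) r) =
          -((-(r * mu D α r * d r / ff D (u r)) - lam * Pn D α (ps D) r) / (r * mu D α r)) := by
        unfold Q
        rw [cl_eq (Ioo_subset_Icc_self hr)]
        have := (ff_pos D (u r)).ne'
        have := (mu_pos D α r).ne'
        have := hr.1.ne'
        field_simp
        ring
      rw [h7]
      exact neg_nonpos.2 (div_nonneg h5 h6.le)
  intro r hr
  constructor
  · have := hz hr (right_mem_Icc.2 zero_le_one) hr.2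
    simpa [hu1, G_zero, W_one] using this
  · exact hz (left_mem_Icc.2 zero_le_one) hr hr.1

lemma ps_le_M {s t : ℝ} (hs : s ∈ Ico (0:ℝ) 1) (ht : t ∈ Icc 0 s) : ps D t ≤ D.M s * ph D t := by
  have htm : t ∈ Icc (0:ℝ) 1 := ⟨ht.1, ht.2.trans hs.2.le⟩
  have h1 := (D.M_def s hs).2 ⟨t, ht, rfl⟩
  have h2 := D.phi_pos t ⟨ht.1, ht.2.trans_lt hs.2⟩
  unfold ps ph
  rw [cl_eq htm]
  exact (div_le_iff₀ h2).1 h1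

lemma M_nonneg {s : ℝ} (hs : s ∈ Ico (0:ℝ) 1) : 0 ≤ D.M s := by
  have h1 := (D.M_def s hs).2 ⟨0, ⟨le_rfl, hs.1⟩, rfl⟩
  simp only [D.psi_zero, D.phi_zero] at h1
  linarith

lemma Pn_ph (α s : ℝ) : α * Pn D α (ph D) s = mu D α s - 1 := by
  have h : ∫ t in (0:ℝ)..s, α * t * ph D t * mu D α t = mu D α s - mu D α 0 := by
    apply intervalIntegral.integral_eq_sub_of_hasDerivAt (fun t _ => mu_deriv D α t)
    apply Continuous.intervalIntegrable
    exact ((continuous_const.mul continuous_id).mul (ph_cont D)).mul (mu_cont D α)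
  rw [mu_zero] at h
  rw [← h]
  unfold Pn
  rw [← intervalIntegral.integral_const_mul]
  congr 1; ext t; ring

lemma Pn_ps_le {α : ℝ} (hα : 0 < α) {s : ℝ} (hs : s ∈ Ico (0:ℝ) 1) :
    α * Pn D α (ps D) s ≤ D.M s * mu D α s := by
  have h1 : Pn D α (ps D) s ≤ D.M s * Pn D α (ph D) s := by
    rw [← Pn_const_mul]
    exact Pn_mono D (ps_cont D) (continuous_const.mul (ph_cont D)) hs.1
      fun t ht => ps_le_M D hs ht
  have h2 := Pn_ph D α s
  have h3 := M_nonneg D hs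
  nlinarith [mul_le_mul_of_nonneg_left h1 hα.le]

lemma Q_ps_le {α : ℝ} (hα : 0 < α) {s : ℝ} (hs : s ∈ Ioo (0:ℝ) 1) :
    α * Q D α (ps D) s ≤ D.M s / s := by
  unfold Q
  rw [cl_eq (Ioo_subset_Icc_self hs)]
  have h := Pn_ps_le D hα (Ioo_subset_Ico_self hs)
  have := mu_pos D α s
  have := hs.1
  rw [← mul_div_assoc, div_le_div_iff₀ (by positivity) hs.1]
  nlinarith

lemma Q_ps_sq {α : ℝ} (hα : 0 < α) {s : ℝ} (hs : s ∈ Ioo (0:ℝ) 1) :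
    α * Q D α (ps D) s ^ 2 ≤ D.M s := by
  have h1 := Q_ps_le D hα hs
  have h2 := Q_le D hα.le (ps_cont D) zero_le_one (fun t _ => ps_le D t) s
  have h3 := Q_nonneg (α := α) D (ps_cont D) (ps_nn D) s
  rw [cl_eq (Ioo_subset_Icc_self hs), one_mul] at h2
  have h4 := M_nonneg D (Ioo_subset_Ico_self hs)
  rw [le_div_iff₀ hs.1] at h1
  nlinarith [mul_le_mul_of_nonneg_left h2 (mul_nonneg hα.le h3)]

lemma W_le {α : ℝ} (hα : 0 < α) {r : ℝ} (hr : r ∈ Ioc (0:ℝ) 1) :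
    α * W D α (ps D) r ≤ (∫ s in Ioo (0:ℝ) 1, D.M s) / r := by
  unfold W
  have hsub : Ioo r 1 ⊆ Ioo (0:ℝ) 1 := Ioo_subset_Ioo_left hr.1.le
  rw [intervalIntegral.integral_of_le hr.2, integral_Ioc_eq_integral_Ioo, ← integral_const_mul]
  have hi : IntegrableOn (fun s => α * Q D α (ps D) s) (Ioo r 1) :=
    ((continuous_const.mul (Q_cont D hα.le (ps_cont D) (ps_nn D))).integrableOn_Icc).mono_set
      Ioo_subset_Icc_self
  calc ∫ s in Ioo r 1, α * Q D α (ps D) s ≤ ∫ s in Ioo r 1, D.M s / r := by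
        apply setIntegral_mono_on hi ((D.M_int.mono_set hsub).div_const r) measurableSet_Ioo
        intro s hs
        refine (Q_ps_le D hα (hsub hs)).trans ?_
        exact div_le_div_of_nonneg_left (M_nonneg D (Ioo_subset_Ico_self (hsub hs))) hr.1 hs.1.le
    _ = (∫ s in Ioo r 1, D.M s) / r := integral_div _ _
    _ ≤ _ := by
        apply div_le_div_of_nonneg_right _ hr.1.le
        apply setIntegral_mono_set D.M_int
        · filter_upwards [ae_restrict_mem measurableSet_Ioo] with s hs
            using M_nonneg D (Ioo_subset_Ico_self hs)
        · exact hsub.eventuallyLE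

lemma W_zero_tendsto : Tendsto (fun α => α * W D α (ps D) 0) atTop atTop := by
  obtain ⟨δ, hδ0, hδ1, hδ⟩ := exists_delta D
  rw [tendsto_atTop]
  intro b
  obtain ⟨η, hη0, hηδ, hηb⟩ : ∃ η, 0 < η ∧ η < δ ∧ b ≤ 1/4 * Real.log (δ / η) := by
    refine ⟨δ * Real.exp (-(4 * |b| + 1)), by positivity, ?_, ?_⟩
    · apply mul_lt_of_lt_one_right hδ0
      rw [Real.exp_lt_one_iff]
      have := abs_nonneg b; linarith
    · rw [div_mul_eq_div_div, div_self hδ0.ne', one_div (Real.exp _), ← Real.exp_neg, Real.log_exp]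
      have := le_abs_self b; linarith
  have hI : 0 < ∫ s in (0:ℝ)..η, s * ph D s := by
    apply intervalIntegral.integral_pos hη0 (continuous_id.mul (ph_cont D)).continuousOn
    · exact fun t ht => mul_nonneg ht.1.le (ph_nonneg D t)
    · exact ⟨η, ⟨hη0.le, le_rfl⟩, mul_pos hη0 (ph_pos D ⟨hη0.le, hηδ.trans hδ1⟩)⟩
  have hmu : Tendsto (fun α => mu D α η) atTop atTop :=
    Real.tendsto_exp_atTop.comp (tendsto_id.atTop_mul_const hI)
  filter_upwards [hmu.eventually_ge_atTop 2, eventually_gt_atTop 0] with α hα2 hα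
  have hQc := Q_cont D hα.le (ps_cont D) (ps_nn D)
  have hlow : ∀ s ∈ Icc η δ, 1/4 * s⁻¹ ≤ α * Q D α (ps D) s := by
    intro s hs
    have hs0 : 0 < s := hη0.trans_le hs.1
    have hms := mu_pos D α s
    unfold Q
    rw [cl_eq ⟨hs0.le, hs.2.trans hδ1.le⟩]
    have h1 : 1/2 * Pn D α (ph D) s ≤ Pn D α (ps D) s := by
      rw [← Pn_const_mul]
      apply Pn_mono D (continuous_const.mul (ph_cont D)) (ps_cont D) hs0.le
      intro t ht
      have := hδ t ⟨ht.1, ht.2.trans hs.2⟩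
      have := ph_le D t
      change 1/2 * ph D t ≤ ps D t
      linarith
    have h2 := Pn_ph D α s
    have h3 : 2 ≤ mu D α s := hα2.trans (mu_mono D hα.le hη0.le hs0.le hs.1)
    have h4 := mul_le_mul_of_nonneg_left h1 hα.le
    rw [← mul_div_assoc, ← div_eq_mul_inv, div_le_div_iff₀ hs0 (mul_pos hs0 hms)]
    nlinarith
  have hsplit : W D α (ps D) 0 ≥ ∫ s in η..δ, Q D α (ps D) s := by
    unfold W
    apply intervalIntegral.integral_mono_interval hη0.le hηδ.le hδ1.le
    · exact Eventually.of_forall fun s => Q_nonneg D (ps_cont D) (ps_nn D) s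
    · exact hQc.intervalIntegrable _ _
  have h5 : ∫ s in η..δ, 1/4 * s⁻¹ ≤ ∫ s in η..δ, α * Q D α (ps D) s := by
    apply intervalIntegral.integral_mono_on hηδ.le _
      ((continuous_const.mul hQc).intervalIntegrable _ _) hlow
    apply ContinuousOn.intervalIntegrable
    rw [uIcc_of_le hηδ.le]
    exact continuousOn_const.mul (continuousOn_inv₀.mono fun s hs => (hη0.trans_le hs.1).ne')
  rw [intervalIntegral.integral_const_mul, intervalIntegral.integral_const_mul,
    integral_inv_of_pos hη0 hδ0] at h5
  nlinarith [mul_le_mul_of_nonneg_left hsplit hα.le]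

theorem super_ok {α lam ρ c δ : ℝ} (hα : 0 < α) (hlam : 0 < lam) (hρ : 1 < ρ)
    (hc : c = ρ ^ 2 * lam) (hcK : c * W D α (ps D) 0 < D.K)
    (hδ0 : 0 < δ) (hδ1 : δ < 1) (hδ : ∀ r ∈ Icc 0 δ, 1/2 ≤ ps D r)
    (h1 : ρ * ff D (Gi D (c * W D α (ps D) 0) + 1) * c * D.M δ ≤ α * ((ρ - 1) / 2))
    (h2 : ff D (Gi D (c * W D α (ps D) δ)) ≤ ρ * ff D 0) :
    lam ∈ solvableSet D α := by
  set w := W D α (ps D) with hw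
  have hwc : Continuous w := W_cont D hα.le (ps_cont D) (ps_nn D)
  have hwa : Antitone w := W_anti D hα.le (ps_cont D) (ps_nn D)
  have hwn : ∀ r, r ≤ 1 → 0 ≤ w r := fun r hr => W_nonneg D (ps_cont D) (ps_nn D) hr
  have hwd : ∀ r, HasDerivAt w (- Q D α (ps D) r) r := W_deriv D hα.le (ps_cont D) (ps_nn D)
  have hcp : 0 < c := by rw [hc]; positivity
  have hmem : ∀ r ∈ Icc (0:ℝ) 1, c * w r ∈ Ico 0 D.K := fun r hr =>
    ⟨mul_nonneg hcp.le (hwn r hr.2),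
      (mul_le_mul_of_nonneg_left (hwa hr.1) hcp.le).trans_lt hcK⟩
  set U : ℝ → ℝ := fun r => Gi D (c * w (cl r)) with hU
  have hUc : Continuous U := by
    rw [continuous_iff_continuousAt]
    intro r
    exact ContinuousAt.comp (f := fun r => c * w (cl r)) (g := Gi D)
      (Gi_deriv D (hmem _ (cl_mem r))).continuousAt
      (continuous_const.mul (hwc.comp cl_cont)).continuousAt
  have hUe : ∀ r ∈ Icc (0:ℝ) 1, U r = Gi D (c * w r) := fun r hr => by
    simp only [hU, cl_eq hr]
  have h01 : (0:ℝ) ∈ Icc (0:ℝ) 1 := left_mem_Icc.2 zero_le_one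
  have hU0 : ∀ r, 0 ≤ U r := fun r => Gi_nonneg D (hmem _ (cl_mem r))
  have hUB : ∀ r, U r ≤ Gi D (c * w 0) := fun r =>
    Gi_mono D (hmem _ (cl_mem r)) (hmem 0 h01)
      (mul_le_mul_of_nonneg_left (hwa (cl_mem r).1) hcp.le)
  have hUd : ∀ r ∈ Ioo (0:ℝ) 1, HasDerivAt U (ff D (U r) * (c * - Q D α (ps D) r)) r := by
    intro r hr
    have hrI := Ioo_subset_Icc_self hr
    have e := (Gi_deriv D (hmem r hrI)).comp r ((hwd r).const_mul c)
    rw [← hUe r hrI] at e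
    apply e.congr_of_eventuallyEq
    filter_upwards [Icc_mem_nhds hr.1 hr.2] with x hx using hUe x hx
  have hUpos : ∀ r ∈ Ioo (0:ℝ) 1, 0 < U r := by
    intro r hr
    have hrI := Ioo_subset_Icc_self hr
    have hwp : 0 < w r := W_pos D hα.le (ps_cont D) (ps_nn D) (by rw [ps_zero]; norm_num)
      (Ioo_subset_Ico_self hr)
    rw [hUe r hrI, ← (G_strict D).lt_iff_lt, G_zero, G_Gi D (hmem r hrI)]
    positivity
  set g : ℝ → ℝ := fun s => lam * (ps D s * ff D (U s)) with hg
  have hgc : Continuous g := src_cont D lam hUc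
  have hg0 : ∀ t ∈ Icc (0:ℝ) 1, 0 ≤ g t := fun t _ => src_nonneg D hlam.le U t
  have hPd := Pn_deriv D α (ps_cont D)
  have hPgd := Pn_deriv D α hgc
  have hPc := Pn_cont D α (ps_cont D)
  have hPgc := Pn_cont D α hgc
  have hPn : ∀ s, 0 ≤ s → 0 ≤ Pn D α (ps D) s := fun s hs =>
    Pn_nonneg D (ps_cont D) hs fun t _ => ps_nonneg D t
  have hffU : Continuous fun s => ff D (U s) := (ff_cont D).comp hUc
  have hMδ := M_nonneg D ⟨hδ0.le, hδ1⟩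
  have key1 : ∀ s ∈ Icc 0 δ, Pn D α g s ≤ ρ * lam * ff D (U s) * Pn D α (ps D) s := by
    have hm : MonotoneOn (fun s => ρ * lam * ff D (U s) * Pn D α (ps D) s - Pn D α g s)
        (Icc 0 δ) := by
      have hder : ∀ s ∈ Ioo 0 δ, HasDerivAt
          (fun s => ρ * lam * ff D (U s) * Pn D α (ps D) s - Pn D α g s)
          (lam * ff D (U s) * (s * mu D α s) * ((ρ - 1) * ps D s
            - ρ * deriv (ff D) (U s) * c * Q D α (ps D) s ^ 2)) s := by
        intro s hs
        have hs1 : s ∈ Ioo (0:ℝ) 1 := ⟨hs.1, hs.2.trans hδ1⟩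
        have e1 := (ff_diff D (hUpos s hs1)).comp s (hUd s hs1)
        have e2 := ((e1.const_mul (ρ * lam)).mul (hPd s)).sub (hPgd s)
        refine e2.congr_deriv ?_
        have e3 : Pn D α (ps D) s = Q D α (ps D) s * (s * mu D α s) := by
          unfold Q
          rw [cl_eq (Ioo_subset_Icc_self hs1), div_mul_cancel₀]
          exact (mul_pos hs.1 (mu_pos D α s)).ne'
        simp only [hg, Function.comp]
        rw [e3]
        ring
      apply monotoneOn_of_deriv_nonneg (convex_Icc 0 δ)
      · exact (((continuous_const.mul hffU).mul hPc).sub hPgc).continuousOn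
      · rw [interior_Icc]
        exact fun s hs => (hder s hs).differentiableAt.differentiableWithinAt
      · rw [interior_Icc]
        intro s hs
        have hs1 : s ∈ Ioo (0:ℝ) 1 := ⟨hs.1, hs.2.trans hδ1⟩
        rw [(hder s hs).deriv]
        have b1 : 0 ≤ lam * ff D (U s) * (s * mu D α s) :=
          mul_nonneg (mul_nonneg hlam.le (ff_pos D _).le) (mul_nonneg hs.1.le (mu_pos D α s).le)
        apply mul_nonneg b1
        have b2 := ff_deriv_nonneg D (U s)
        have b3 := ff_deriv_le D (hUpos s hs1) (hUB s)
        have b4 : α * Q D α (ps D) s ^ 2 ≤ D.M δ := by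
          refine (Q_ps_sq D hα hs1).trans ?_
          obtain ⟨t, ht, hte⟩ := (D.M_def s (Ioo_subset_Ico_self hs1)).1
          rw [← hte]
          exact (D.M_def δ ⟨hδ0.le, hδ1⟩).2 ⟨t, ⟨ht.1, ht.2.trans hs.2.le⟩, rfl⟩
        have b5 := hδ s ⟨hs.1.le, hs.2.le⟩
        have b6 : α * (ρ * deriv (ff D) (U s) * c * Q D α (ps D) s ^ 2)
            ≤ ρ * ff D (Gi D (c * w 0) + 1) * c * D.M δ := by
          calc α * (ρ * deriv (ff D) (U s) * c * Q D α (ps D) s ^ 2)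
              = (ρ * deriv (ff D) (U s) * c) * (α * Q D α (ps D) s ^ 2) := by ring
            _ ≤ (ρ * deriv (ff D) (U s) * c) * D.M δ :=
                mul_le_mul_of_nonneg_left b4 (by positivity)
            _ ≤ _ := by gcongr
        have b7 := le_of_mul_le_mul_left (b6.trans h1) hα
        nlinarith
    intro s hs
    have := hm (left_mem_Icc.2 hδ0.le) hs hs.1
    simp only [Pn_zero] at this
    linarith
  have key2 : ∀ s ∈ Icc δ 1, Pn D α g s ≤ ρ * lam * ff D (U δ) * Pn D α (ps D) s := by
    have hm : MonotoneOn (fun s => ρ * lam * ff D (U δ) * Pn D α (ps D) s - Pn D α g s)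
        (Icc δ 1) := by
      have hder : ∀ s, HasDerivAt
          (fun s => ρ * lam * ff D (U δ) * Pn D α (ps D) s - Pn D α g s)
          (ρ * lam * ff D (U δ) * (ps D s * (s * mu D α s)) - g s * (s * mu D α s)) s :=
        fun s => ((hPd s).const_mul _).sub (hPgd s)
      apply monotoneOn_of_deriv_nonneg (convex_Icc δ 1)
      · exact ((continuous_const.mul hPc).sub hPgc).continuousOn
      · exact fun s hs => (hder s).differentiableAt.differentiableWithinAt
      · rw [interior_Icc]
        intro s hs
        have hs1 : s ∈ Ioo (0:ℝ) 1 := ⟨hδ0.trans hs.1, hs.2⟩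
        rw [(hder s).deriv]
        have b1 : 0 ≤ lam * (ps D s * (s * mu D α s)) :=
          mul_nonneg hlam.le (mul_nonneg (ps_nonneg D s) (mul_nonneg hs1.1.le (mu_pos D α s).le))
        have b2 : U s ≤ U δ := by
          rw [hUe s (Ioo_subset_Icc_self hs1), hUe δ ⟨hδ0.le, hδ1.le⟩]
          exact Gi_mono D (hmem s (Ioo_subset_Icc_self hs1)) (hmem δ ⟨hδ0.le, hδ1.le⟩)
            (mul_le_mul_of_nonneg_left (hwa hs.1.le) hcp.le)
        have b3 := ff_mono D b2
        have b4 : 0 ≤ ρ * ff D (U δ) - ff D (U s) := by nlinarith [ff_pos D (U δ)]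
        have b5 := mul_nonneg b1 b4
        simp only [hg]
        linarith
    intro s hs
    have b1 := hm (left_mem_Icc.2 hδ1.le) hs hs.1
    have b2 := key1 δ (right_mem_Icc.2 hδ0.le)
    simp only at b1
    linarith
  have key : ∀ s ∈ Icc (0:ℝ) 1, Pn D α g s ≤ c * ff D (U s) * Pn D α (ps D) s := by
    intro s hs
    have hp := hPn s hs.1
    have hf := ff_pos D (U s)
    rcases le_total s δ with h | h
    · refine (key1 s ⟨hs.1, h⟩).trans ?_
      apply mul_le_mul_of_nonneg_right _ hp
      apply mul_le_mul_of_nonneg_right _ hf.le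
      rw [hc]
      nlinarith [mul_pos (sub_pos.2 hρ) hlam]
    · refine (key2 s ⟨h, hs.2⟩).trans ?_
      apply mul_le_mul_of_nonneg_right _ hp
      rw [← hUe δ ⟨hδ0.le, hδ1.le⟩] at h2
      have b1 : ff D 0 ≤ ff D (U s) := ff_mono D (hU0 s)
      calc ρ * lam * ff D (U δ) ≤ ρ * lam * (ρ * ff D (U s)) := by
            apply mul_le_mul_of_nonneg_left _ (by positivity)
            exact h2.trans (mul_le_mul_of_nonneg_left b1 (by linarith))
        _ = c * ff D (U s) := by rw [hc]; ring
  have hsup : ∀ r ∈ Icc (0:ℝ) 1, W D α g r ≤ U r := by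
    have hm : AntitoneOn (fun r => U r - W D α g r) (Icc 0 1) := by
      have hder : ∀ r ∈ Ioo (0:ℝ) 1, HasDerivAt (fun r => U r - W D α g r)
          (ff D (U r) * (c * - Q D α (ps D) r) - (- Q D α g r)) r := fun r hr =>
        (hUd r hr).sub (W_deriv D hα.le hgc hg0 r)
      apply antitoneOn_of_deriv_nonpos (convex_Icc 0 1)
      · exact (hUc.sub (W_cont D hα.le hgc hg0)).continuousOn
      · rw [interior_Icc]
        exact fun r hr => (hder r hr).differentiableAt.differentiableWithinAt
      · rw [interior_Icc]
        intro r hr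
        rw [(hder r hr).deriv]
        have b1 := key r (Ioo_subset_Icc_self hr)
        have b2 : Q D α g r ≤ c * ff D (U r) * Q D α (ps D) r := by
          unfold Q
          rw [cl_eq (Ioo_subset_Icc_self hr), ← mul_div_assoc]
          exact div_le_div_of_nonneg_right b1 (mul_pos hr.1 (mu_pos D α r)).le
        linarith
    intro r hr
    have b1 := hm hr (right_mem_Icc.2 zero_le_one) hr.2
    have b2 := hU0 1
    simp only [W_one] at b1
    linarith
  have hT : ∀ r, T D α lam U r ≤ U r := by
    intro r
    have b1 := hsup (cl r) (cl_mem r)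
    have b2 : U (cl r) = U r := by simp only [hU, cl_eq (cl_mem r)]
    rw [b2] at b1
    exact b1
  obtain ⟨v, hvc, hv⟩ := exists_fix D hα.le hlam.le hUc hU0 hUB hT
  exact ⟨hlam, v, sol_of_fix D hα.le hlam hvc hv⟩

lemma w0_pos {α : ℝ} (hα : 0 < α) : 0 < W D α (ps D) 0 :=
  W_pos D hα.le (ps_cont D) (ps_nn D) (by rw [ps_zero]; norm_num) ⟨le_rfl, zero_lt_one⟩

theorem lower {θ : ℝ} (hθ0 : 0 < θ) (hθ1 : θ < 1) :
    ∀ᶠ α in atTop, θ * D.K / W D α (ps D) 0 ∈ solvableSet D α := by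
  obtain ⟨δ, hδ0, hδ1, hδ⟩ := exists_delta D
  obtain ⟨ρ, hρ, hρθ⟩ : ∃ ρ, 1 < ρ ∧ ρ ^ 2 * θ < 1 :=
    ⟨1 + (1 - θ) / 4, by linarith, by nlinarith [mul_pos hθ0 (sub_pos.2 hθ1), mul_pos (mul_pos hθ0 (sub_pos.2 hθ1)) (sub_pos.2 hθ1)]⟩
  have hK := K_pos D
  set K1 := ρ ^ 2 * θ * D.K with hK1
  have hK1K : K1 < D.K := by
    have := mul_lt_mul_of_pos_right hρθ hK
    linarith
  have hK1p : 0 < K1 := by positivity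
  have hinv : Tendsto (fun α => (α * W D α (ps D) 0)⁻¹) atTop (𝓝 0) :=
    tendsto_inv_atTop_zero.comp (W_zero_tendsto D)
  set Cδ := (∫ s in Ioo (0:ℝ) 1, D.M s) / δ with hCδ
  have hE1 : ∀ᶠ α in atTop, ρ * ff D (Gi D K1 + 1) * K1 * D.M δ * (α * W D α (ps D) 0)⁻¹
      < (ρ - 1) / 2 := by
    have := hinv.const_mul (ρ * ff D (Gi D K1 + 1) * K1 * D.M δ)
    rw [mul_zero] at this
    exact this.eventually_lt_const (by linarith)
  have hlim2 : Tendsto (fun α => K1 * Cδ * (α * W D α (ps D) 0)⁻¹) atTop (𝓝 0) := by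
    have := hinv.const_mul (K1 * Cδ)
    rwa [mul_zero] at this
  have h0K : (0:ℝ) ∈ Ico 0 D.K := ⟨le_rfl, hK⟩
  have hE2 : ∀ᶠ y in 𝓝 (0:ℝ), ff D (Gi D y) < ρ * ff D 0 := by
    have hc : ContinuousAt (fun y => ff D (Gi D y)) 0 :=
      (ff_cont D).continuousAt.comp (Gi_deriv D h0K).continuousAt
    apply hc.eventually_lt_const
    have : Gi D 0 = 0 := by
      have := Gi_G D 0
      rwa [G_zero] at this
    simp only [this]
    nlinarith [ff_pos D 0]
  filter_upwards [hE1, hlim2.eventually hE2, hlim2.eventually_lt_const hK, eventually_gt_atTop 0]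
    with α e1 e2 e3 hα
  have hw0 := w0_pos D hα
  have hcw : ρ ^ 2 * (θ * D.K / W D α (ps D) 0) * W D α (ps D) 0 = K1 := by
    rw [hK1]; field_simp
  apply super_ok D hα (by positivity) hρ rfl (δ := δ) _ hδ0 hδ1 hδ
  · rw [hcw]
    have : ρ * ff D (Gi D K1 + 1) * (ρ ^ 2 * (θ * D.K / W D α (ps D) 0)) * D.M δ
        = α * (ρ * ff D (Gi D K1 + 1) * K1 * D.M δ * (α * W D α (ps D) 0)⁻¹) := by
      rw [hK1]; field_simp
    rw [this]
    exact mul_le_mul_of_nonneg_left e1.le hα.le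
  · have hle : ρ ^ 2 * (θ * D.K / W D α (ps D) 0) * W D α (ps D) δ
        ≤ K1 * Cδ * (α * W D α (ps D) 0)⁻¹ := by
      have b1 := W_le D hα (r := δ) ⟨hδ0, hδ1.le⟩
      have b2 : ρ ^ 2 * (θ * D.K / W D α (ps D) 0) * W D α (ps D) δ
        = K1 * (α * W D α (ps D) δ) * (α * W D α (ps D) 0)⁻¹ := by
        rw [hK1]; field_simp
      rw [b2]
      apply mul_le_mul_of_nonneg_right _ (by positivity)
      exact mul_le_mul_of_nonneg_left b1 hK1p.le
    have hnn : 0 ≤ ρ ^ 2 * (θ * D.K / W D α (ps D) 0) * W D α (ps D) δ := by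
      have := W_nonneg (α := α) D (ps_cont D) (ps_nn D) hδ1.le
      positivity
    exact (ff_mono D (Gi_mono D ⟨hnn, hle.trans_lt e3⟩ ⟨hnn.trans hle, e3⟩ hle)).trans e2.le
  · rw [hcw]; exact hK1K

lemma solv_le {α lam : ℝ} (hα : 0 < α) (h : lam ∈ solvableSet D α) :
    lam ≤ D.K / W D α (ps D) 0 := by
  obtain ⟨_, u, hu⟩ := h
  have h1 := (sol_bounds D hα.le hu 0 (left_mem_Icc.2 zero_le_one)).1
  have h2 := G_lt D (u 0)
  rw [le_div_iff₀ (w0_pos D hα)]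
  linarith

lemma star_tendsto : Tendsto (fun α => lamStar D α * W D α (ps D) 0) atTop (𝓝 D.K) := by
  have hK := K_pos D
  rw [tendsto_order]
  constructor
  · intro a ha
    obtain ⟨θ, hθ1, hθ2⟩ : ∃ θ, max 0 (a / D.K) < θ ∧ θ < 1 :=
      exists_between (max_lt zero_lt_one ((div_lt_one hK).2 ha))
    have hθ0 := (le_max_left _ _).trans_lt hθ1
    have hθa := (le_max_right _ _).trans_lt hθ1
    rw [div_lt_iff₀ hK] at hθa
    filter_upwards [lower D hθ0 hθ2, eventually_gt_atTop 0] with α h1 hα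
    have h2 : θ * D.K / W D α (ps D) 0 ≤ lamStar D α :=
      le_csSup ⟨_, fun x hx => solv_le D hα hx⟩ h1
    rw [div_le_iff₀ (w0_pos D hα)] at h2
    linarith
  · intro b hb
    filter_upwards [lower D (θ := 1/2) (by norm_num) (by norm_num), eventually_gt_atTop 0]
      with α h1 hα
    have h2 : lamStar D α ≤ D.K / W D α (ps D) 0 :=
      csSup_le ⟨_, h1⟩ fun x hx => solv_le D hα hx
    rw [le_div_iff₀ (w0_pos D hα)] at h2
    linarith

theorem main (u : ℝ → ℝ → ℝ)
    (hu : ∀ᶠ α in atTop, IsSolution D α (lamStar D α) (u α)) :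
    (∀ r ∈ Ioc (0:ℝ) 1, Tendsto (fun α => u α r) atTop (nhds 0)) ∧
      Tendsto (fun α => u α 0) atTop atTop := by
  have hst := star_tendsto D
  have hK := K_pos D
  constructor
  · intro r hr
    have hrI := Ioc_subset_Icc_self hr
    have hinv : Tendsto (fun α => (α * W D α (ps D) 0)⁻¹) atTop (𝓝 0) :=
      tendsto_inv_atTop_zero.comp (W_zero_tendsto D)
    set C := (∫ s in Ioo (0:ℝ) 1, D.M s) / r with hC
    have hlim : Tendsto (fun α => D.K - lamStar D α * W D α (ps D) 0
        + lamStar D α * W D α (ps D) 0 * (C * (α * W D α (ps D) 0)⁻¹)) atTop (𝓝 0) := by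
      have := (hst.const_sub D.K).add (hst.mul (hinv.const_mul C))
      simpa using this
    rw [tendsto_order]
    constructor
    · intro a ha
      filter_upwards [hu] with α h
      refine ha.trans_le ?_
      rcases eq_or_lt_of_le hr.2 with h1 | h1
      · rw [h1, h.2.2.2.2.1]
      · exact (h.2.2.1 r ⟨hr.1.le, h1⟩).le
    · intro b hb
      have hGb : 0 < G D b := by
        have := G_strict D hb
        rwa [G_zero] at this
      filter_upwards [hu, hlim.eventually_lt_const hGb, eventually_gt_atTop 0,
        hst.eventually_const_lt hK] with α h h1 hα hpos
      have hw0 := w0_pos D hα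
      have hl : 0 < lamStar D α := pos_of_mul_pos_left hpos hw0.le
      have h2 := (sol_bounds D hα.le h r hrI).2
      have h3 := G_lt D (u α 0)
      have h4 := W_le D hα hr
      have h5 : lamStar D α * W D α (ps D) r
          ≤ lamStar D α * W D α (ps D) 0 * (C * (α * W D α (ps D) 0)⁻¹) := by
        have : lamStar D α * W D α (ps D) 0 * (C * (α * W D α (ps D) 0)⁻¹)
            = lamStar D α * (C / α) := by field_simp
        rw [this]
        apply mul_le_mul_of_nonneg_left _ hl.le
        rw [le_div_iff₀ hα]; linarith
      rw [← (G_strict D).lt_iff_lt]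
      linarith
  · rw [tendsto_atTop]
    intro b
    filter_upwards [hu, hst.eventually_const_lt (G_lt D b), eventually_gt_atTop 0] with α h h1 hα
    have h2 := (sol_bounds D hα.le h 0 (left_mem_Icc.2 zero_le_one)).1
    rw [← (G_strict D).le_iff_le]
    linarith

end GP

/-- If `u_α` is a solution of `(P_{α, λ*(α)})` for every sufficiently
large `α`, then `u_α r → 0` for every fixed `r ∈ (0,1]`, and `u_α 0 → ∞`, as `α → ∞`. -/
theorem extremal_pointwise_limit (D : GelfandData) (u : ℝ → ℝ → ℝ)
    (hu : ∀ᶠ α in atTop, IsSolution D α (lamStar D α) (u α)) :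
    (∀ r ∈ Ioc (0:ℝ) 1, Tendsto (fun α => u α r) atTop (nhds 0)) ∧
      Tendsto (fun α => u α 0) atTop atTop := by
  exact GP.main D u hu
end
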